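/- arXiv:2202.06291 — 4 statements merged into one kernel-verified Lean document; each statement's English description precedes it below -/
import Mathlib

section
/- Let B be a commutative ring, P a finitely generated projective B-module, and a, b ∈ B with aB + bB = B. Let σ be an automorphism of P_{ab} (the localization of P at ab) which is isotopic to the identity, i.e., there exists Φ(W) ∈ Aut(P_{ab}[W]) with Φ(0) = Id and Φ(1) = σ. Then σ = τ_a ∘ θ_b, where τ ∈ Aut(P_b) satisfies τ ≡ Id modulo aB_b and θ ∈ Aut(P_a) satisfies θ ≡ Id modulo bB_a. (Quillen splitting.) -/
open TensorProduct

/-- Evaluation `Q[W] → Q` at `W = c`, where `Q[W] = R[W] ⊗_R Q`. -/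
noncomputable def evalTensor (R M : Type*) [CommRing R] [AddCommGroup M] [Module R M]
    (c : R) : (Polynomial R ⊗[R] M) →ₗ[R] M :=
  (TensorProduct.lid R M).toLinearMap ∘ₗ
    LinearMap.rTensor M (Polynomial.aeval c).toLinearMap

/-- An automorphism `σ` of a module `M` is isotopic to the identity if there is an automorphism
`Φ(W)` of `M[W]` with `Φ(0) = Id` and `Φ(1) = σ`. -/
def IsotopicToId {R M : Type*} [CommRing R] [AddCommGroup M] [Module R M]
    (σ : M ≃ₗ[R] M) : Prop :=
  ∃ Φ : (Polynomial R ⊗[R] M) ≃ₗ[Polynomial R] (Polynomial R ⊗[R] M),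
    (∀ x : M, evalTensor R M 0 (Φ ((1 : Polynomial R) ⊗ₜ[R] x)) = x) ∧
    (∀ x : M, evalTensor R M 1 (Φ ((1 : Polynomial R) ⊗ₜ[R] x)) = σ x)

section EvalTensor

variable {R M E : Type*} [CommRing R] [AddCommGroup M] [Module R M] [AddCommGroup E] [Module R E]

@[simp]
lemma evalTensor_tmul (c : R) (p : Polynomial R) (m : M) :
    evalTensor R M c (p ⊗ₜ[R] m) = p.eval c • m := by
  simp [evalTensor, Polynomial.aeval_def, Polynomial.eval₂_eq_eval_map]

lemma evalTensor_smul (c : R) (p : Polynomial R) (y : Polynomial R ⊗[R] M) :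
    evalTensor R M c (p • y) = p.eval c • evalTensor R M c y := by
  induction y with
  | zero => simp
  | tmul q m => simp [TensorProduct.smul_tmul', mul_smul]
  | add y z hy hz => simp [smul_add, hy, hz]

lemma evalTensor_lTensor (f : M →ₗ[R] E) (c : R) (y : Polynomial R ⊗[R] M) :
    evalTensor R E c (f.lTensor (Polynomial R) y) = f (evalTensor R M c y) := by
  induction y with
  | zero => simp
  | tmul q m => simp
  | add y z hy hz => simp [hy, hz]

lemma evalTensor_rTensor_aeval (q : Polynomial R) (c : R) (y : Polynomial R ⊗[R] M) :
    evalTensor R M c ((Polynomial.aeval q).toLinearMap.rTensor M y) =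
      evalTensor R M (q.eval c) y := by
  induction y with
  | zero => simp
  | tmul p m => simp [Polynomial.aeval_def, ← Polynomial.comp.eq_1, Polynomial.eval_comp,
      Polynomial.algebraMap_eq]
  | add y z hy hz => simp [hy, hz]

/-- The specialization at `W = c` of an endomorphism of `M[W]`. -/
noncomputable def specialize (Φ : (Polynomial R ⊗[R] M) →ₗ[Polynomial R] (Polynomial R ⊗[R] M))
    (c : R) : Module.End R M :=
  evalTensor R M c ∘ₗ Φ.restrictScalars R ∘ₗ TensorProduct.mk R (Polynomial R) M 1

lemma specialize_apply (Φ : (Polynomial R ⊗[R] M) →ₗ[Polynomial R] (Polynomial R ⊗[R] M))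
    (c : R) (x : M) : specialize Φ c x = evalTensor R M c (Φ (1 ⊗ₜ[R] x)) := rfl

lemma specialize_evalTensor
    (Φ : (Polynomial R ⊗[R] M) →ₗ[Polynomial R] (Polynomial R ⊗[R] M)) (c : R)
    (y : Polynomial R ⊗[R] M) :
    specialize Φ c (evalTensor R M c y) = evalTensor R M c (Φ y) := by
  induction y with
  | zero => simp
  | tmul p m =>
    have h : p ⊗ₜ[R] m = p • ((1 : Polynomial R) ⊗ₜ[R] m) := by
      simp [TensorProduct.smul_tmul']
    rw [h, evalTensor_smul, map_smul (specialize Φ c), map_smul Φ, evalTensor_smul,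
      evalTensor_tmul, Polynomial.eval_one, one_smul, specialize_apply]
  | add y z hy hz => simp [hy, hz]

lemma specialize_mul (Φ Ψ : (Polynomial R ⊗[R] M) →ₗ[Polynomial R] (Polynomial R ⊗[R] M)) (c : R) :
    specialize Φ c * specialize Ψ c = specialize (Φ ∘ₗ Ψ) c := by
  ext x
  rw [Module.End.mul_apply, specialize_apply Ψ, specialize_evalTensor]
  rfl

lemma specialize_id (c : R) : specialize (LinearMap.id (R := Polynomial R)
    (M := Polynomial R ⊗[R] M)) c = 1 := by
  ext x
  simp [specialize_apply]

/-- Specializations of an endomorphism of `M[W]` are values of a polynomial with coefficients in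
`End M` when `M` is finitely generated projective. -/
lemma exists_evalTensor_eq_specialize [Module.Finite R M] [Module.Projective R M]
    (Φ : (Polynomial R ⊗[R] M) →ₗ[Polynomial R] (Polynomial R ⊗[R] M)) :
    ∃ t : Polynomial R ⊗[R] Module.End R M,
      ∀ c, evalTensor R (Module.End R M) c t = specialize Φ c := by
  obtain ⟨n, f, g, -, -, hfg⟩ := Module.Finite.exists_comp_eq_id_of_projective R M
  let φ : Fin n → (M →ₗ[R] R) := fun i ↦ LinearMap.proj i ∘ₗ g
  let e : Fin n → M := fun i ↦ f (Pi.single i 1)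
  have he : ∀ x, ∑ i, φ i x • e i = x := by
    intro x
    have h : f (g x) = x := LinearMap.congr_fun hfg x
    conv_rhs => rw [← h, pi_eq_sum_univ' (g x), map_sum]
    refine Finset.sum_congr rfl fun i _ ↦ ?_
    rw [map_smul]
    simp only [φ, e, LinearMap.comp_apply, LinearMap.proj_apply]
  refine ⟨∑ i, (LinearMap.smulRightₗ (φ i)).lTensor (Polynomial R) (Φ (1 ⊗ₜ e i)), fun c ↦ ?_⟩
  ext x
  rw [map_sum, LinearMap.sum_apply]
  simp only [evalTensor_lTensor, LinearMap.smulRightₗ_apply, ← specialize_apply]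
  conv_rhs => rw [← he x, map_sum]
  simp

end EvalTensor

section Descent

variable {B A R N M : Type*} [CommRing B] [CommRing A] [CommRing R] [Algebra B A]
  [AddCommGroup N] [Module B N] [Module A N] [IsScalarTower B A N]
  [AddCommGroup M] [Module B M] [Module R M]

lemma exists_lift_evalTensor_sub [Algebra B R] [IsScalarTower B R M] (j : N →ₗ[B] M) (a : B)
    (hlift : ∀ c : Module.End R M, ∃ (k : ℕ) (d : Module.End A N), ∀ x, a ^ k • c (j x) = j (d x))
    (K : ℕ) (t : Polynomial R ⊗[R] Module.End R M) :
    ∃ n : ℕ, ∀ z : B, ∃ d : Module.End A N, ∀ x,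
      evalTensor R (Module.End R M) (algebraMap B R (a ^ n * z)) t (j x) =
        evalTensor R (Module.End R M) 0 t (j x) + j (a ^ K • d x) := by
  have hadd : ∀ t t' : Polynomial R ⊗[R] Module.End R M,
      (∃ n : ℕ, ∀ z : B, ∃ d : Module.End A N, ∀ x,
        evalTensor R (Module.End R M) (algebraMap B R (a ^ n * z)) t (j x) =
          evalTensor R (Module.End R M) 0 t (j x) + j (a ^ K • d x)) →
      (∃ n : ℕ, ∀ z : B, ∃ d : Module.End A N, ∀ x,
        evalTensor R (Module.End R M) (algebraMap B R (a ^ n * z)) t' (j x) =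
          evalTensor R (Module.End R M) 0 t' (j x) + j (a ^ K • d x)) →
      ∃ n : ℕ, ∀ z : B, ∃ d : Module.End A N, ∀ x,
        evalTensor R (Module.End R M) (algebraMap B R (a ^ n * z)) (t + t') (j x) =
          evalTensor R (Module.End R M) 0 (t + t') (j x) + j (a ^ K • d x) := by
    rintro t t' ⟨n, h⟩ ⟨n', h'⟩
    refine ⟨n + n', fun z ↦ ?_⟩
    obtain ⟨d, hd⟩ := h (a ^ n' * z)
    obtain ⟨d', hd'⟩ := h' (a ^ n * z)
    refine ⟨d + d', fun x ↦ ?_⟩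
    have e : a ^ (n + n') * z = a ^ n * (a ^ n' * z) := by ring
    have e' : a ^ (n + n') * z = a ^ n' * (a ^ n * z) := by ring
    have hd := hd x
    have hd' := hd' x
    rw [← e] at hd
    rw [← e'] at hd'
    simp only [map_add, LinearMap.add_apply, hd, hd', smul_add]
    abel
  induction t with
  | zero => exact ⟨0, fun z ↦ ⟨0, fun x ↦ by simp⟩⟩
  | add t t' h h' => exact hadd t t' h h'
  | tmul p c =>
    induction p using Polynomial.induction_on with
    | C u => exact ⟨0, fun z ↦ ⟨0, fun x ↦ by simp⟩⟩
    | add p q hp hq =>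
      rw [TensorProduct.add_tmul]
      exact hadd _ _ hp hq
    | monomial n u _ =>
      obtain ⟨k, d, hd⟩ := hlift (u • c)
      refine ⟨K + k, fun z ↦ ⟨LinearMap.lsmul B (Module.End A N)
        (z * (a ^ (K + k) * z) ^ n) d, fun x ↦ ?_⟩⟩
      have h0 : evalTensor R (Module.End R M) 0 ((Polynomial.C u * Polynomial.X ^ (n + 1)) ⊗ₜ c)
          = 0 := by simp
      have h1 : evalTensor R (Module.End R M) (algebraMap B R (a ^ (K + k) * z))
          ((Polynomial.C u * Polynomial.X ^ (n + 1)) ⊗ₜ c) =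
            algebraMap B R ((a ^ (K + k) * z) ^ (n + 1)) • (u • c) := by
        rw [evalTensor_tmul, smul_smul, map_pow, Polynomial.eval_mul, Polynomial.eval_C,
          Polynomial.eval_pow, Polynomial.eval_X, mul_comm]
      rw [h0, h1, LinearMap.zero_apply, zero_add, LinearMap.smul_apply, algebraMap_smul,
        LinearMap.lsmul_apply, map_smul j, LinearMap.smul_apply _ d, map_smul j, ← hd, smul_smul,
        smul_smul]
      congr 1
      ring

lemma exists_equiv_lift (j : N →ₗ[B] M) (a : B) (hinj : ∀ y : M, a • y = 0 → y = 0) (K : ℕ)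
    (hker : ∀ x, j x = 0 → a ^ K • x = 0) (f g : Module.End R M) (hfg : f * g = 1)
    (hgf : g * f = 1) (d e : Module.End A N) (hd : ∀ x, f (j x) = j x + j (a ^ K • d x))
    (he : ∀ x, g (j x) = j x + j (a ^ K • e x)) :
    ∃ τ : N ≃ₗ[A] N, (∀ x, f (j x) = j (τ x)) ∧ ∀ x, τ x - x = a ^ K • d x := by
  have hinj' : ∀ (n : ℕ) (y : M), a ^ n • y = 0 → y = 0 := by
    intro n
    induction n with
    | zero => intro y hy; simpa using hy
    | succ n ih => intro y hy; exact hinj _ (ih _ (by rwa [smul_smul, ← pow_succ]))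
  have key : ∀ (f g : Module.End R M) (_ : f * g = 1) (d e : Module.End A N)
      (_ : ∀ x, f (j x) = j x + j (a ^ K • d x)) (_ : ∀ x, g (j x) = j x + j (a ^ K • e x)),
      (1 + LinearMap.lsmul B (Module.End A N) (a ^ K) d) ∘ₗ
        (1 + LinearMap.lsmul B (Module.End A N) (a ^ K) e) = LinearMap.id := by
    intro f g hfg d e hd he
    ext x
    have h1 : j (a ^ K • (e x + d x + d (a ^ K • e x))) = 0 := by
      have h := LinearMap.congr_fun hfg (j x)
      rw [Module.End.mul_apply, he, ← map_add, hd, Module.End.one_apply, ← map_add] at h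
      rw [← sub_eq_zero, ← map_sub] at h
      rw [← h]
      congr 1
      simp only [map_add, smul_add]
      abel
    have h2 := hker _ (hinj' K _ (by rwa [← map_smul]))
    simp only [LinearMap.comp_apply, LinearMap.add_apply, Module.End.one_apply,
      LinearMap.lsmul_apply, LinearMap.smul_apply, LinearMap.id_apply]
    rw [← sub_eq_zero, ← h2]
    simp only [map_add, smul_add]
    abel
  refine ⟨LinearEquiv.ofLinearMap _ _ (key f g hfg d e hd he) (key g f hgf e d he hd),
    fun x ↦ ?_, fun x ↦ ?_⟩
  · simp [hd]
  · simp

lemma exists_equiv_lift_evalTensor [Algebra B R] [IsScalarTower B R M] (j : N →ₗ[B] M) (a : B)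
    (hinj : ∀ y : M, a • y = 0 → y = 0) (m : ℕ) (hker : ∀ x, j x = 0 → a ^ m • x = 0)
    (hlift : ∀ c : Module.End R M, ∃ (k : ℕ) (d : Module.End A N), ∀ x, a ^ k • c (j x) = j (d x))
    (t t' : Polynomial R ⊗[R] Module.End R M)
    (h : ∀ r, evalTensor R (Module.End R M) r t * evalTensor R (Module.End R M) r t' = 1)
    (h' : ∀ r, evalTensor R (Module.End R M) r t' * evalTensor R (Module.End R M) r t = 1)
    (h0 : evalTensor R (Module.End R M) 0 t = 1) :
    ∃ n : ℕ, ∀ z : B, ∃ τ : N ≃ₗ[A] N,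
      (∀ x, evalTensor R (Module.End R M) (algebraMap B R (a ^ n * z)) t (j x) = j (τ x)) ∧
      ∀ x, τ x - x ∈ Ideal.span {algebraMap B A a} • (⊤ : Submodule A N) := by
  have h0' : evalTensor R (Module.End R M) 0 t' = 1 := by simpa [h0] using h 0
  obtain ⟨n, hn⟩ := exists_lift_evalTensor_sub j a hlift (m + 1) t
  obtain ⟨n', hn'⟩ := exists_lift_evalTensor_sub j a hlift (m + 1) t'
  refine ⟨n + n', fun z ↦ ?_⟩
  obtain ⟨d, hd⟩ := hn (a ^ n' * z)
  obtain ⟨e, he⟩ := hn' (a ^ n * z)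
  rw [show a ^ n * (a ^ n' * z) = a ^ (n + n') * z by ring, h0] at hd
  rw [show a ^ n' * (a ^ n * z) = a ^ (n + n') * z by ring, h0'] at he
  obtain ⟨τ, hτ, hτ'⟩ := exists_equiv_lift j a hinj (m + 1)
    (fun x hx ↦ by rw [pow_succ', mul_smul, hker x hx, smul_zero]) _ _ (h _) (h' _) d e hd he
  refine ⟨τ, hτ, fun x ↦ ?_⟩
  rw [hτ', pow_succ', mul_smul, ← algebraMap_smul A a]
  exact Submodule.smul_mem_smul (Ideal.mem_span_singleton_self _) trivial

end Descent

section Localization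

variable {B P : Type*} [CommRing B] [AddCommGroup P] [Module B P]

lemma LocalizedModule.smul_eq_zero_iff (S : Submonoid B) {s : B} (hs : s ∈ S)
    (y : LocalizedModule S P) : s • y = 0 ↔ y = 0 := by
  refine ⟨fun h ↦ ?_, fun h ↦ by rw [h, smul_zero]⟩
  have := IsLocalizedModule.smul_injective (LocalizedModule.mkLinearMap S P) ⟨s, hs⟩
  exact this (by simpa [Submonoid.smul_def] using h)

/-- Elements of `P_b` with zero image in `P_{ab}` are killed by a uniform power of `a`. -/
lemma exists_pow_smul_eq_zero_of_localization [IsNoetherianRing B] [Module.Finite B P]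
    (S : Submonoid B) (a b : B) (hS : ∀ s ∈ S, ∃ k l : ℕ, a ^ k * b ^ l = s)
    (j : LocalizedModule (Submonoid.powers b) P →ₗ[B] LocalizedModule S P)
    (hj : j ∘ₗ LocalizedModule.mkLinearMap (Submonoid.powers b) P =
      LocalizedModule.mkLinearMap S P) :
    ∃ m : ℕ, ∀ x, j x = 0 → a ^ m • x = 0 := by
  have hx : ∀ x, j x = 0 → ∃ k : ℕ, a ^ k • x = 0 := by
    intro x hx
    obtain ⟨⟨p, s⟩, hps⟩ := IsLocalizedModule.surj (Submonoid.powers b)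
      (LocalizedModule.mkLinearMap (Submonoid.powers b) P) x
    rw [Submonoid.smul_def] at hps
    have h0 : LocalizedModule.mkLinearMap S P p = 0 := by
      rw [← hj, LinearMap.comp_apply, ← hps, map_smul, hx, smul_zero]
    obtain ⟨⟨u, hu⟩, hup⟩ := (IsLocalizedModule.eq_zero_iff S _).mp h0
    obtain ⟨k, l, rfl⟩ := hS u hu
    refine ⟨k, ?_⟩
    rw [← LocalizedModule.smul_eq_zero_iff (Submonoid.powers b) (s := b ^ l * s)
      (mul_mem ⟨l, rfl⟩ s.2), smul_smul, show b ^ l * (s : B) * a ^ k = a ^ k * b ^ l * s by ring,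
      mul_smul, hps, ← map_smul]
    simp only [Submonoid.smul_def] at hup
    rw [hup, map_zero]
  let f : Module.End (Localization (Submonoid.powers b)) (LocalizedModule (Submonoid.powers b) P) :=
    algebraMap B _ a
  have hf : ∀ (k : ℕ) x, (f ^ k) x = a ^ k • x := fun k x ↦ by
    rw [← map_pow, Module.algebraMap_end_apply]
  obtain ⟨m, hm⟩ := f.eventually_iSup_ker_pow_eq.exists
  refine ⟨m, fun x h ↦ ?_⟩
  obtain ⟨k, hk⟩ := hx x h
  rw [← hf, ← LinearMap.mem_ker, ← hm]
  exact Submodule.mem_iSup_of_mem k (by rw [LinearMap.mem_ker, hf, hk])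

/-- Endomorphisms of `P_{ab}` descend to `P_b` after multiplication by a power of `a`. -/
lemma exists_lift_end_localization [Module.FinitePresentation B P]
    (S : Submonoid B) (a b : B) (hb : b ∈ S) (hS : ∀ s ∈ S, ∃ k l : ℕ, a ^ k * b ^ l = s)
    (j : LocalizedModule (Submonoid.powers b) P →ₗ[B] LocalizedModule S P)
    (hj : j ∘ₗ LocalizedModule.mkLinearMap (Submonoid.powers b) P =
      LocalizedModule.mkLinearMap S P)
    (c : Module.End (Localization S) (LocalizedModule S P)) :
    ∃ (k : ℕ) (d : Module.End (Localization (Submonoid.powers b))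
      (LocalizedModule (Submonoid.powers b) P)), ∀ x, a ^ k • c (j x) = j (d x) := by
  obtain ⟨h, ⟨s, hs⟩, hh⟩ := Module.FinitePresentation.exists_lift_of_isLocalizedModule S
    (LocalizedModule.mkLinearMap S P) (c.restrictScalars B ∘ₗ LocalizedModule.mkLinearMap S P)
  obtain ⟨k, l, rfl⟩ := hS s hs
  have hjp : ∀ p, j (LocalizedModule.mkLinearMap (Submonoid.powers b) P p) =
      LocalizedModule.mkLinearMap S P p := LinearMap.congr_fun hj
  have hhp : ∀ p, LocalizedModule.mkLinearMap S P (h p) =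
      (a ^ k * b ^ l) • c (LocalizedModule.mkLinearMap S P p) := LinearMap.congr_fun hh
  let u : Localization (Submonoid.powers b) := Localization.mk 1 ⟨b ^ l, l, rfl⟩
  have hu : algebraMap B _ (b ^ l) * u = 1 := by
    rw [← Localization.mk_one_eq_algebraMap, Localization.mk_mul, one_mul, mul_one]
    exact Localization.mk_self (⟨b ^ l, l, rfl⟩ : Submonoid.powers b)
  have hu' : ∀ y : LocalizedModule (Submonoid.powers b) P, b ^ l • u • y = y := fun y ↦ by
    rw [← algebraMap_smul (Localization (Submonoid.powers b)) (b ^ l) (u • y), smul_smul, hu,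
      one_smul]
  refine ⟨k, u • LocalizedModule.map (Submonoid.powers b) h, fun x ↦ ?_⟩
  rw [← sub_eq_zero, ← LocalizedModule.smul_eq_zero_iff S (pow_mem hb l), smul_sub, sub_eq_zero,
    ← map_smul j, LinearMap.smul_apply, hu', smul_smul, mul_comm]
  obtain ⟨⟨p, s⟩, hps⟩ := IsLocalizedModule.surj (Submonoid.powers b)
    (LocalizedModule.mkLinearMap (Submonoid.powers b) P) x
  rw [Submonoid.smul_def] at hps
  have hsS : (s : B) ∈ S := (Submonoid.powers_le.mpr hb) s.2
  rw [← sub_eq_zero, ← LocalizedModule.smul_eq_zero_iff S hsS, smul_sub, sub_eq_zero,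
    smul_comm, ← map_smul j, ← LinearMap.map_smul_of_tower c (s : B),
    ← LinearMap.map_smul_of_tower (LocalizedModule.map (Submonoid.powers b) h),
    ← map_smul j, hps, hjp, ← hhp]
  simp only [LocalizedModule.mkLinearMap_apply, LocalizedModule.map_mk]
  exact (hjp _).symm

end Localization

/-- Quillen splitting: if `a, b` are comaximal in `B` and `σ ∈ Aut(P_{ab})` is isotopic to the
identity, then `σ = τ_a ∘ θ_b` with `τ ∈ Aut(P_b)`, `τ ≡ Id mod a`, `θ ∈ Aut(P_a)`,
`θ ≡ Id mod b`.  Here `ja`, `jb` denote the canonical localization maps `P_a, P_b → P_{ab}`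
(`B_{ab}` is the localization at the submonoid generated by `a` and `b`), and `τ'`, `θ'` are
the localizations `τ_a`, `θ_b` of `τ`, `θ` to `P_{ab}`, characterized by compatibility with
`jb`, `ja`. -/
theorem stmt3 (B : Type*) [CommRing B] [IsNoetherianRing B]
    (P : Type*) [AddCommGroup P] [Module B P] [Module.Finite B P] [Module.Projective B P]
    (a b : B) (hab : Ideal.span {a, b} = ⊤)
    (σ : (LocalizedModule (Submonoid.closure {a, b}) P)
      ≃ₗ[Localization (Submonoid.closure {a, b})]
      (LocalizedModule (Submonoid.closure {a, b}) P))
    (hσ : IsotopicToId σ)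
    (jb : (LocalizedModule (Submonoid.powers b) P) →ₗ[B]
      (LocalizedModule (Submonoid.closure {a, b}) P))
    (hjb : jb ∘ₗ LocalizedModule.mkLinearMap (Submonoid.powers b) P =
      LocalizedModule.mkLinearMap (Submonoid.closure {a, b}) P)
    (ja : (LocalizedModule (Submonoid.powers a) P) →ₗ[B]
      (LocalizedModule (Submonoid.closure {a, b}) P))
    (hja : ja ∘ₗ LocalizedModule.mkLinearMap (Submonoid.powers a) P =
      LocalizedModule.mkLinearMap (Submonoid.closure {a, b}) P) :
    ∃ (τ : (LocalizedModule (Submonoid.powers b) P) ≃ₗ[Localization (Submonoid.powers b)]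
        (LocalizedModule (Submonoid.powers b) P))
      (θ : (LocalizedModule (Submonoid.powers a) P) ≃ₗ[Localization (Submonoid.powers a)]
        (LocalizedModule (Submonoid.powers a) P))
      (τ' θ' : (LocalizedModule (Submonoid.closure {a, b}) P)
        ≃ₗ[Localization (Submonoid.closure {a, b})]
        (LocalizedModule (Submonoid.closure {a, b}) P)),
      (∀ x, τ' (jb x) = jb (τ x)) ∧
      (∀ x, θ' (ja x) = ja (θ x)) ∧
      (∀ x, τ x - x ∈
        (Ideal.span {algebraMap B (Localization (Submonoid.powers b)) a}) •
          (⊤ : Submodule (Localization (Submonoid.powers b))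
            (LocalizedModule (Submonoid.powers b) P))) ∧
      (∀ x, θ x - x ∈
        (Ideal.span {algebraMap B (Localization (Submonoid.powers a)) b}) •
          (⊤ : Submodule (Localization (Submonoid.powers a))
            (LocalizedModule (Submonoid.powers a) P))) ∧
      (∀ x, σ x = τ' (θ' x)) := by
  obtain ⟨Φ, hΦ0, hΦ1⟩ := hσ
  let S := Submonoid.closure {a, b}
  have ha : a ∈ S := Submonoid.subset_closure (by simp)
  have hb : b ∈ S := Submonoid.subset_closure (by simp)
  have hS : ∀ s ∈ S, ∃ k l : ℕ, a ^ k * b ^ l = s := fun s hs ↦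
    (Submonoid.mem_closure_pair a b s).mp hs
  have hS' : ∀ s ∈ S, ∃ k l : ℕ, b ^ k * a ^ l = s := fun s hs ↦ by
    obtain ⟨k, l, h⟩ := hS s hs
    exact ⟨l, k, by rw [mul_comm, h]⟩
  have : Module.FinitePresentation B P := Module.finitePresentation_of_projective B P
  obtain ⟨ma, hma⟩ := exists_pow_smul_eq_zero_of_localization S b a hS' ja hja
  obtain ⟨mb, hmb⟩ := exists_pow_smul_eq_zero_of_localization S a b hS jb hjb
  let R := Localization S
  let M := LocalizedModule S P
  let α : R → Module.End R M := specialize Φ.toLinearMap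
  let α' : R → Module.End R M := specialize Φ.symm.toLinearMap
  have hα : ∀ r, α r * α' r = 1 := fun r ↦ by
    simp only [α, α', specialize_mul, LinearEquiv.comp_symm, specialize_id]
  have hα' : ∀ r, α' r * α r = 1 := fun r ↦ by
    simp only [α, α', specialize_mul, LinearEquiv.symm_comp, specialize_id]
  have hα0 : α 0 = 1 := LinearMap.ext hΦ0
  have hα1 : α 1 = σ.toLinearMap := LinearMap.ext hΦ1
  obtain ⟨t, ht⟩ := exists_evalTensor_eq_specialize Φ.toLinearMap
  obtain ⟨t', ht'⟩ := exists_evalTensor_eq_specialize Φ.symm.toLinearMap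
  let q : Polynomial R := 1 - Polynomial.X
  let ρ := (Polynomial.aeval (R := R) q).toLinearMap.rTensor (Module.End R M)
  have hs : ∀ r, evalTensor R (Module.End R M) r
      ((LinearMap.mulLeft R (α 1)).lTensor (Polynomial R) (ρ t')) = α 1 * α' (1 - r) := fun r ↦ by
    rw [evalTensor_lTensor, evalTensor_rTensor_aeval, ht', LinearMap.mulLeft_apply]
    simp [q, α']
  have hs' : ∀ r, evalTensor R (Module.End R M) r
      ((LinearMap.mulRight R (α' 1)).lTensor (Polynomial R) (ρ t)) = α (1 - r) * α' 1 := fun r ↦ by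
    rw [evalTensor_lTensor, evalTensor_rTensor_aeval, ht, LinearMap.mulRight_apply]
    simp [q, α]
  have hss' : ∀ r, (α 1 * α' (1 - r)) * (α (1 - r) * α' 1) = 1 := fun r ↦ by
    rw [mul_assoc, ← mul_assoc (α' _), hα', one_mul, hα]
  have hs's : ∀ r, (α (1 - r) * α' 1) * (α 1 * α' (1 - r)) = 1 := fun r ↦ by
    rw [mul_assoc, ← mul_assoc (α' _), hα', one_mul, hα]
  obtain ⟨na, hna⟩ := exists_equiv_lift_evalTensor ja b
    (fun y ↦ (LocalizedModule.smul_eq_zero_iff S hb y).mp) ma hma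
    (exists_lift_end_localization S b a ha hS' ja hja) t t'
    (fun r ↦ by rw [ht, ht']; exact hα r) (fun r ↦ by rw [ht, ht']; exact hα' r)
    ((ht 0).trans hα0)
  obtain ⟨nb, hnb⟩ := exists_equiv_lift_evalTensor jb a
    (fun y ↦ (LocalizedModule.smul_eq_zero_iff S ha y).mp) mb hmb
    (exists_lift_end_localization S a b hb hS jb hjb)
    ((LinearMap.mulLeft R (α 1)).lTensor (Polynomial R) (ρ t'))
    ((LinearMap.mulRight R (α' 1)).lTensor (Polynomial R) (ρ t))
    (fun r ↦ by rw [hs, hs']; exact hss' r) (fun r ↦ by rw [hs, hs']; exact hs's r)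
    (by rw [hs, sub_zero, hα])
  have hcop : IsCoprime a b := by
    rw [← Ideal.isCoprime_span_singleton_iff, Ideal.isCoprime_iff_sup_eq, ← Ideal.span_union,
      Set.singleton_union, hab]
  obtain ⟨u, v, huv⟩ := hcop.pow (m := nb) (n := na)
  obtain ⟨τ, hτ, hτ1⟩ := hnb u
  obtain ⟨θ, hθ, hθ1⟩ := hna v
  have hτ' : ∀ x, (α 1 * α' (1 - algebraMap B R (a ^ nb * u))) (jb x) = jb (τ x) := fun x ↦
    (LinearMap.congr_fun (hs _) (jb x)).symm.trans (hτ x)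
  have hθ' : ∀ x, α (algebraMap B R (b ^ na * v)) (ja x) = ja (θ x) := fun x ↦
    (LinearMap.congr_fun (ht _) (ja x)).symm.trans (hθ x)
  have hr : 1 - algebraMap B R (a ^ nb * u) = algebraMap B R (b ^ na * v) := by
    rw [sub_eq_iff_eq_add, ← map_add, ← map_one (algebraMap B R), ← huv]
    congr 1
    ring
  refine ⟨τ, θ, LinearEquiv.ofLinearMap _ _ (hss' (algebraMap B R (a ^ nb * u))) (hs's _),
    LinearEquiv.ofLinearMap _ _ (hα (algebraMap B R (b ^ na * v))) (hα' _), hτ', hθ', hτ1, hθ1,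
    fun x ↦ ?_⟩
  have hfin : α 1 = (α 1 * α' (1 - algebraMap B R (a ^ nb * u))) *
      α (algebraMap B R (b ^ na * v)) := by
    rw [hr, mul_assoc, hα', mul_one]
  exact (LinearMap.congr_fun hα1 x).symm.trans (LinearMap.congr_fun hfin x)
end

section
/- Let A be a commutative Noetherian ring containing an infinite field k and let P be a finitely generated projective A[T]-module of rank n. If P_f has a unimodular element for some monic polynomial f ∈ A[T], then there exists a surjection α : P ↠ I, where I is an ideal of A[T] of height ≥ n containing a monic polynomial. -/
/-- The height of an ideal: the infimum of the dimensions of localizations at primes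
containing it. -/
noncomputable def idealHt {A : Type*} [CommRing A] (I : Ideal A) : WithBot (WithTop ℕ) :=
  ⨅ p ∈ {p : PrimeSpectrum A | I ≤ p.asIdeal}, ringKrullDim (Localization.AtPrime p.asIdeal)

/-- A module has a unimodular element if some element is mapped to `1` by a linear functional. -/
def HasUnimodular (R M : Type*) [CommRing R] [AddCommGroup M] [Module R M] : Prop :=
  ∃ (m : M) (φ : M →ₗ[R] R), φ m = 1

/-- The local rank of a module at every prime, as a constant-rank condition. -/
def HasRank (R M : Type*) [CommRing R] [AddCommGroup M] [Module R M] (n : ℕ) : Prop :=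
  ∀ p : PrimeSpectrum R,
    Module.rank (Localization.AtPrime p.asIdeal) (LocalizedModule p.asIdeal.primeCompl M) = n


section SpanRank

variable {R σ : Type*} [CommRing R]

/-- The coordinatewise image of a vector over `R` in an `R`-algebra `F`. -/
def coordMap (F : Type*) [Field F] [Algebra R F] : (σ → R) →ₗ[R] (σ → F) :=
  (Algebra.linearMap R F).compLeft σ

@[simp]
theorem coordMap_apply (F : Type*) [Field F] [Algebra R F] (v : σ → R) (j : σ) :
    coordMap F v j = algebraMap R F (v j) := rfl

/-- The span over `F` of the images of a set of vectors over `R`. -/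
abbrev spanOver (F : Type*) [Field F] [Algebra R F] (U : Set (σ → R)) : Submodule F (σ → F) :=
  Submodule.span F (Set.image (coordMap F) U)

/-- The rank over `F` of a set of vectors over `R`. -/
noncomputable abbrev rankOver (F : Type*) [Field F] [Algebra R F] (U : Set (σ → R)) : ℕ :=
  Module.finrank F (spanOver F U)

/-- The ideal generated by the `r × r` minors of the matrix with rows in `U`. -/
def minorIdeal (U : Set (σ → R)) (r : ℕ) : Ideal R :=
  Ideal.span {d | ∃ (g : Fin r → σ → R) (h : Fin r → σ), (∀ i, g i ∈ U) ∧
    d = (Matrix.of fun i j => g i (h j)).det}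

theorem exists_minor_ne_zero {F : Type*} [Field F] [Finite σ] {r : ℕ} {g : Fin r → σ → F}
    (hg : LinearIndependent F g) :
    ∃ h : Fin r → σ, (Matrix.of fun i j => g i (h j)).det ≠ 0 := by
  have := Fintype.ofFinite σ
  have hrank : Module.finrank F (Submodule.span F (Set.range (Matrix.of g).col)) = r := by
    rw [← Matrix.rank_eq_finrank_span_cols]
    simpa using LinearIndependent.rank_matrix (M := Matrix.of g) hg
  obtain ⟨c, hc, -, hli⟩ :=
    Submodule.exists_fun_fin_finrank_span_eq F (Set.range (Matrix.of g).col)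
  choose h hh using hc
  refine ⟨h ∘ Fin.cast hrank.symm, ?_⟩
  rw [← isUnit_iff_ne_zero, ← Matrix.isUnit_iff_isUnit_det,
    ← Matrix.linearIndependent_cols_iff_isUnit]
  have hcol : (Matrix.of fun i j => g i ((h ∘ Fin.cast hrank.symm) j)).col =
      c ∘ Fin.cast hrank.symm := by
    ext j i
    simp [← hh]
  rw [hcol]
  exact hli.comp _ (Fin.cast_injective hrank.symm)

theorem minorIdeal_le_ker_iff {F : Type*} [Field F] [Algebra R F] [Finite σ]
    {U : Set (σ → R)} {r : ℕ} :
    minorIdeal U r ≤ RingHom.ker (algebraMap R F) ↔ rankOver F U < r := by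
  rw [minorIdeal, Ideal.span_le]
  constructor
  · intro hU
    by_contra! hr
    obtain ⟨g, hg, -, hli⟩ := Submodule.exists_fun_fin_finrank_span_eq F (coordMap F '' U)
    have hli' := hli.comp (Fin.castLE hr) (Fin.castLE_injective hr)
    obtain ⟨h, hh⟩ := exists_minor_ne_zero hli'
    choose u hu hgu using hg
    refine hh ?_
    have := hU ⟨fun i => u (Fin.castLE hr i), h, fun i => hu _, rfl⟩
    rw [SetLike.mem_coe, RingHom.mem_ker, RingHom.map_det] at this
    rw [← this]
    congr 1
    ext i j
    simp [← hgu]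
  · rintro hr _ ⟨g, h, hg, rfl⟩
    rw [SetLike.mem_coe, RingHom.mem_ker]
    by_contra hdet
    rw [RingHom.map_det] at hdet
    have hli := Matrix.linearIndependent_rows_iff_isUnit.2
      ((Matrix.isUnit_iff_isUnit_det _).2 (isUnit_iff_ne_zero.2 hdet))
    have hli' : LinearIndependent F (fun i => coordMap F (g i)) := by
      refine LinearIndependent.of_comp (LinearMap.funLeft F F h) ?_
      exact hli
    have hle : Submodule.span F (Set.range fun i => coordMap F (g i)) ≤ spanOver F U :=
      Submodule.span_mono (Set.range_subset_iff.2 fun i => Set.mem_image_of_mem _ (hg i))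
    have := Submodule.finrank_mono hle
    rw [finrank_span_eq_card hli', Fintype.card_fin] at this
    exact this.not_gt hr

theorem rankOver_anti [Finite σ] {p q : Ideal R} [p.IsPrime] [q.IsPrime] (hqp : q ≤ p)
    (U : Set (σ → R)) : rankOver p.ResidueField U ≤ rankOver q.ResidueField U := by
  by_contra! h
  have := minorIdeal_le_ker_iff.2 h
  rw [Ideal.ker_algebraMap_residueField] at this
  have := minorIdeal_le_ker_iff.1
    ((this.trans hqp).trans_eq p.ker_algebraMap_residueField.symm)
  exact this.false

theorem spanOver_insert (F : Type*) [Field F] [Algebra R F] (v : σ → R) (U : Set (σ → R)) :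
    spanOver F (insert v U) = Submodule.span F {coordMap F v} ⊔ spanOver F U := by
  rw [spanOver, Set.image_insert_eq, Submodule.span_insert]

theorem spanOver_le_insert (F : Type*) [Field F] [Algebra R F] (v : σ → R) (U : Set (σ → R)) :
    spanOver F U ≤ spanOver F (insert v U) :=
  Submodule.span_mono (Set.image_mono (Set.subset_insert v U))

theorem rankOver_insert_le {F : Type*} [Field F] [Algebra R F] [Finite σ] (v : σ → R)
    (U : Set (σ → R)) : rankOver F (insert v U) ≤ rankOver F U + 1 := by
  rw [rankOver, spanOver_insert]
  refine (Submodule.finrank_add_le_finrank_add_finrank _ _).trans ?_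
  rw [add_comm]
  gcongr
  exact (finrank_span_le_card _).trans (by simp)

theorem spanOver_insert_of_mem {F : Type*} [Field F] [Algebra R F] {v : σ → R}
    {U : Set (σ → R)} (hv : coordMap F v ∈ spanOver F U) :
    spanOver F (insert v U) = spanOver F U := by
  rw [spanOver_insert, sup_eq_right, Submodule.span_singleton_le_iff_mem]
  exact hv

theorem finite_setOf_height_add_rankOver_eq [IsNoetherianRing R] [Finite σ] {n : ℕ}
    {φ : σ → R} {U : Set (σ → R)}
    (hU : ∀ (p : Ideal R) [p.IsPrime], coordMap p.ResidueField φ ∈ spanOver p.ResidueField U →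
      (n : ℕ∞) ≤ p.height + rankOver p.ResidueField U) :
    {p : Ideal R | ∃ _ : p.IsPrime, coordMap p.ResidueField φ ∈ spanOver p.ResidueField U ∧
      p.height + rankOver p.ResidueField U = n}.Finite := by
  refine ((Set.finite_Iic n).biUnion fun r _ =>
    (minorIdeal (insert φ U) (r + 1)).finite_minimalPrimes_of_isNoetherianRing R).subset ?_
  rintro p ⟨hp, hφ, hht⟩
  have hle : rankOver p.ResidueField U ≤ n := by
    have : (rankOver p.ResidueField U : ℕ∞) ≤ n := hht ▸ le_add_self
    exact_mod_cast this
  refine Set.mem_biUnion hle ⟨⟨hp, ?_⟩, ?_⟩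
  · refine le_of_le_of_eq ?_ p.ker_algebraMap_residueField
    rw [minorIdeal_le_ker_iff, rankOver, spanOver_insert_of_mem hφ]
    exact Nat.lt_succ_self _
  · rintro q ⟨hq, hmq⟩ hqp
    by_contra hpq
    have hrank := rankOver_anti hqp U
    have hrank' : rankOver q.ResidueField (insert φ U) ≤ rankOver p.ResidueField U := by
      rw [← q.ker_algebraMap_residueField, minorIdeal_le_ker_iff] at hmq
      omega
    have hle := spanOver_le_insert q.ResidueField φ U
    have heq := Submodule.eq_of_le_of_finrank_le hle (hrank'.trans hrank)
    have hφq : coordMap q.ResidueField φ ∈ spanOver q.ResidueField U := by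
      rw [heq]
      exact Submodule.subset_span (Set.mem_image_of_mem _ (Set.mem_insert _ _))
    have hrq : rankOver q.ResidueField U = rankOver p.ResidueField U :=
      le_antisymm ((Submodule.finrank_mono hle).trans hrank') hrank
    have hlt := Ideal.height_strict_mono_of_isPrime_of_isPrime (lt_of_le_not_ge hqp hpq)
    have h1 := hU q hφq
    rw [hrq, ← hht] at h1
    exact hlt.not_ge ((ENat.add_le_add_iff_right (ENat.natCast_ne_top _)).1 h1)

variable {k : Type*} [Field k] [Infinite k] [Algebra k R] [IsNoetherianRing R] [Finite σ]

theorem exists_smul_add_forall_le_height {n : ℕ} {φ v : σ → R} {U : Set (σ → R)}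
    (hU : ∀ (p : Ideal R) [p.IsPrime],
      coordMap p.ResidueField φ ∈ spanOver p.ResidueField (insert v U) →
      (n : ℕ∞) ≤ p.height + rankOver p.ResidueField (insert v U)) :
    ∃ c : k, ∀ (p : Ideal R) [p.IsPrime],
      coordMap p.ResidueField (φ + c • v) ∈ spanOver p.ResidueField U →
      (n : ℕ∞) ≤ p.height + rankOver p.ResidueField U := by
  have hfin := finite_setOf_height_add_rankOver_eq hU
  have hsub (p : Ideal R) : {c : k | ∃ _ : p.IsPrime,
      coordMap p.ResidueField (φ + c • v) ∈ spanOver p.ResidueField U ∧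
      coordMap p.ResidueField v ∉ spanOver p.ResidueField U}.Subsingleton := by
    rintro c ⟨hp, hc, hv⟩ d ⟨_, hd, -⟩
    by_contra hcd
    refine hv ?_
    have h1 := Submodule.sub_mem _ hc hd
    rw [← map_sub, add_sub_add_left_eq_sub, ← sub_smul, ← algebraMap_smul R (c - d) v,
      map_smul, ← algebraMap_smul p.ResidueField] at h1
    refine ((spanOver p.ResidueField U).smul_mem_iff_of_isUnit ?_).1 h1
    exact ((isUnit_iff_ne_zero.2 (sub_ne_zero.2 hcd)).map (algebraMap k R)).map _
  obtain ⟨c, hc⟩ := (hfin.biUnion fun p _ => (hsub p).finite).exists_notMem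
  refine ⟨c, fun p hp hcp => ?_⟩
  have hvmem : coordMap p.ResidueField v ∈ spanOver p.ResidueField (insert v U) :=
    Submodule.subset_span (Set.mem_image_of_mem _ (Set.mem_insert _ _))
  have hφ : coordMap p.ResidueField φ ∈ spanOver p.ResidueField (insert v U) := by
    have h1 := spanOver_le_insert _ v U hcp
    rw [map_add, ← algebraMap_smul R c v, map_smul, ← algebraMap_smul p.ResidueField] at h1
    exact (Submodule.add_mem_iff_left _ (Submodule.smul_mem _ _ hvmem)).1 h1
  have hle := hU p hφ
  by_cases hv : coordMap p.ResidueField v ∈ spanOver p.ResidueField U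
  · rwa [rankOver, spanOver_insert_of_mem hv] at hle
  · have hne : p.height + rankOver p.ResidueField (insert v U) ≠ n := fun h =>
      hc (Set.mem_biUnion (x := p) ⟨hp, hφ, h⟩ ⟨hp, hcp, hv⟩)
    have hlt := Order.add_one_le_of_lt (lt_of_le_of_ne hle hne.symm)
    have h2 : (rankOver p.ResidueField (insert v U) : ℕ∞) ≤
        rankOver p.ResidueField U + 1 := by exact_mod_cast rankOver_insert_le v U
    have h3 := hlt.trans (add_le_add_right h2 p.height)
    rw [← add_assoc] at h3
    exact (ENat.add_le_add_iff_right ENat.one_ne_top).1 h3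

/-- A general translate of `φ` by a `k`-combination of a finite set `U` of vectors vanishes only
in large height. -/
theorem exists_mem_span_forall_le_height (n : ℕ) {U : Set (σ → R)} (hU : U.Finite) (φ : σ → R)
    (h : ∀ (p : Ideal R) [p.IsPrime], coordMap p.ResidueField φ ∈ spanOver p.ResidueField U →
      (n : ℕ∞) ≤ p.height + rankOver p.ResidueField U) :
    ∃ u ∈ Submodule.span k U, ∀ (p : Ideal R) [p.IsPrime],
      coordMap p.ResidueField (φ + u) = 0 → (n : ℕ∞) ≤ p.height := by
  induction U, hU using Set.Finite.induction_on generalizing φ with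
  | empty =>
    refine ⟨0, zero_mem _, fun p _ hp => ?_⟩
    have := h p (by simpa [spanOver] using hp)
    rwa [rankOver, spanOver, Set.image_empty, Submodule.span_empty, finrank_bot, Nat.cast_zero,
      add_zero] at this
  | @insert v U _ _ ih =>
    obtain ⟨c, hc⟩ := exists_smul_add_forall_le_height (k := k) h
    obtain ⟨u, hu, hup⟩ := ih _ hc
    refine ⟨c • v + u, ?_, fun p _ hp => hup p (by rwa [add_assoc])⟩
    exact add_mem (Submodule.smul_mem _ _ (Submodule.subset_span (Set.mem_insert _ _)))
      (Submodule.span_mono (Set.subset_insert _ _) hu)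

end SpanRank

section Projective

open TensorProduct in
theorem finrank_le_rankOver_of_comp_eq_id {R P : Type*} [CommRing R] [AddCommGroup P] [Module R P]
    {m : ℕ} {π : (Fin m → R) →ₗ[R] P} {ι : P →ₗ[R] Fin m → R} (hπι : π ∘ₗ ι = LinearMap.id)
    (F : Type*) [Field F] [Algebra R F] :
    Module.finrank F (F ⊗[R] P) ≤
      rankOver F (Set.range fun i j => ι (π (Pi.single j 1)) i) := by
  have hcomp : π.baseChange F ∘ₗ ι.baseChange F = LinearMap.id := by
    rw [← LinearMap.baseChange_comp, hπι, LinearMap.baseChange_id]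
  have hinj : Function.Injective (ι.baseChange F) :=
    Function.LeftInverse.injective (LinearMap.congr_fun hcomp)
  have hsurj : Function.Surjective (π.baseChange F) :=
    Function.RightInverse.surjective (LinearMap.congr_fun hcomp)
  have hmat := LinearMap.toMatrix_baseChange F (ι ∘ₗ π) (Pi.basisFun R (Fin m))
    (Pi.basisFun R (Fin m))
  have hrank := Matrix.rank_eq_finrank_range_toLin
    (((LinearMap.toMatrix (Pi.basisFun R (Fin m)) (Pi.basisFun R (Fin m))) (ι ∘ₗ π)).map
      (algebraMap R F)) (Algebra.TensorProduct.basis F (Pi.basisFun R (Fin m)))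
      (Algebra.TensorProduct.basis F (Pi.basisFun R (Fin m)))
  rw [← hmat, Matrix.toLin_toMatrix, LinearMap.baseChange_comp, LinearMap.range_comp,
    LinearMap.range_eq_top.2 hsurj, Submodule.map_top, LinearMap.finrank_range_of_inj hinj,
    ← LinearMap.baseChange_comp, hmat,
    Matrix.rank_eq_finrank_span_row] at hrank
  rw [← hrank, rankOver, spanOver, ← Set.range_comp]
  refine le_of_eq ?_
  congr 3

theorem rankAtStalk_eq_of_hasRank {R P : Type*} [CommRing R] [AddCommGroup P] [Module R P] {n : ℕ}
    (h : HasRank R P n) (p : PrimeSpectrum R) : Module.rankAtStalk P p = n := by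
  rw [Module.rankAtStalk, Module.finrank, h p]
  simp

/-- A functional on a projective module of rank `n` can be moved by a `k`-combination of the
coordinates of an embedding into a free module so that its image has height at least `n`. -/
theorem exists_functional_forall_le_height (k : Type*) {R P : Type*} [Field k] [Infinite k]
    [CommRing R] [IsNoetherianRing R] [Algebra k R] [AddCommGroup P] [Module R P]
    [Module.Finite R P] [Module.Projective R P] {n m : ℕ} (h : HasRank R P n)
    {π : (Fin m → R) →ₗ[R] P} {ι : P →ₗ[R] Fin m → R} (hπι : π ∘ₗ ι = LinearMap.id)
    (φ : P →ₗ[R] R) :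
    ∃ c : Fin m → k, ∀ (p : Ideal R) [p.IsPrime],
      LinearMap.range (φ + ∑ i, algebraMap k R (c i) • (LinearMap.proj i ∘ₗ ι)) ≤ p →
      (n : ℕ∞) ≤ p.height := by
  obtain ⟨u, hu, hup⟩ := exists_mem_span_forall_le_height (k := k) n
    (Set.finite_range fun i (j : Fin m) => ι (π (Pi.single j 1)) i)
    (fun j => φ (π (Pi.single j 1))) fun p _ _ => by
      refine le_add_left ?_
      have := finrank_le_rankOver_of_comp_eq_id hπι p.ResidueField
      have h2 := p.finrank_fiber_eq_rankAtStalk (M := P)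
      rw [rankAtStalk_eq_of_hasRank h] at h2
      exact_mod_cast h2.symm.trans_le this
  obtain ⟨c, rfl⟩ := (Submodule.mem_span_range_iff_exists_fun k).1 hu
  refine ⟨c, fun p _ hp => hup p ?_⟩
  ext j
  rw [coordMap_apply, Pi.zero_apply, Ideal.algebraMap_residueField_eq_zero]
  convert hp ⟨π (Pi.single j 1), rfl⟩ using 1
  simp [Algebra.smul_def]

end Projective

open Polynomial

theorem exists_functional_eq_pow {R P : Type*} [CommRing R] [AddCommGroup P] [Module R P]
    [Module.FinitePresentation R P] {f : R}
    (h : HasUnimodular (Localization (Submonoid.powers f))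
      (LocalizedModule (Submonoid.powers f) P)) :
    ∃ (x : P) (φ : P →ₗ[R] R) (d : ℕ), φ x = f ^ d := by
  obtain ⟨y, φ, hφ⟩ := h
  obtain ⟨⟨x, s⟩, rfl⟩ := IsLocalizedModule.mk'_surjective (Submonoid.powers f)
    (LocalizedModule.mkLinearMap (Submonoid.powers f) P) y
  obtain ⟨ψ, t, hψ⟩ := Module.FinitePresentation.exists_lift_of_isLocalizedModule
    (Submonoid.powers f) (Algebra.linearMap R (Localization (Submonoid.powers f)))
    (φ.restrictScalars R ∘ₗ LocalizedModule.mkLinearMap (Submonoid.powers f) P)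
  have h1 : algebraMap R (Localization (Submonoid.powers f)) (ψ x) =
      algebraMap R _ (t * s : R) := by
    have h2 := LinearMap.congr_fun hψ x
    have h3 : (s : R) • IsLocalizedModule.mk' (LocalizedModule.mkLinearMap (Submonoid.powers f) P)
        x s = LocalizedModule.mkLinearMap (Submonoid.powers f) P x :=
      IsLocalizedModule.mk'_cancel' (LocalizedModule.mkLinearMap (Submonoid.powers f) P) x s
    have h4 : (φ.restrictScalars R) ((s : R) • IsLocalizedModule.mk'
        (LocalizedModule.mkLinearMap (Submonoid.powers f) P) x s) = algebraMap R _ (s : R) := by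
      rw [map_smul, LinearMap.restrictScalars_apply]
      erw [hφ]
      rw [Algebra.smul_def, mul_one]
    rw [h3] at h4
    simp only [LinearMap.comp_apply, LinearMap.smul_apply, h4, Algebra.linearMap_apply] at h2
    rw [h2, map_mul, Submonoid.smul_def, Algebra.smul_def]
  obtain ⟨r, hr⟩ := (IsLocalization.eq_iff_exists (Submonoid.powers f) _).1 h1
  obtain ⟨d, hd⟩ := (r * (t * s)).2
  refine ⟨x, (r : R) • ψ, d, ?_⟩
  rw [LinearMap.smul_apply, smul_eq_mul, hr]
  exact hd.symm

/-- If `A` is Noetherian containing an infinite field `k` and `P` is a finitely generated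
projective `A[T]`-module of rank `n` with `P_f` having a unimodular element for some monic `f`,
then there is a surjection `α : P ↠ I` with `I ⊆ A[T]` of height `≥ n` containing a monic. -/
theorem stmt4 (k A : Type*) [Field k] [Infinite k] [CommRing A] [IsNoetherianRing A]
    [Algebra k A] (n : ℕ)
    (P : Type*) [AddCommGroup P] [Module (Polynomial A) P]
    [Module.Finite (Polynomial A) P] [Module.Projective (Polynomial A) P]
    (hrank : HasRank (Polynomial A) P n)
    (f : Polynomial A) (hf : f.Monic)
    (h : HasUnimodular (Localization (Submonoid.powers f))
      (LocalizedModule (Submonoid.powers f) P)) :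
    ∃ (I : Ideal (Polynomial A)) (α : P →ₗ[Polynomial A] Polynomial A),
      LinearMap.range α = I ∧ (n : WithBot (WithTop ℕ)) ≤ idealHt I ∧
      ∃ g ∈ I, g.Monic := by
  have := Module.finitePresentation_of_finite A[X] P
  obtain ⟨x, φ, d, hx⟩ := exists_functional_eq_pow h
  obtain ⟨m, π, ι, -, -, hπι⟩ := Module.Finite.exists_comp_eq_id_of_projective A[X] P
  obtain ⟨N, hN⟩ : ∃ N : ℕ, ∀ i, (ι x i).degree < (N : WithBot ℕ) :=
    ⟨(Finset.univ.sup fun i => (ι x i).natDegree) + 1, fun i => degree_le_natDegree.trans_lt <| by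
      exact_mod_cast Nat.lt_succ_of_le
        (Finset.le_sup (f := fun i => (ι x i).natDegree) (Finset.mem_univ i))⟩
  obtain ⟨c, hc⟩ := exists_functional_forall_le_height k hrank hπι ((X : A[X]) ^ N • φ)
  refine ⟨_, (X : A[X]) ^ N • φ + ∑ i, algebraMap k A[X] (c i) • (LinearMap.proj i ∘ₗ ι), rfl,
    ?_, _, ⟨x, rfl⟩, ?_⟩
  · refine le_iInf₂ fun p hp => ?_
    rw [IsLocalization.AtPrime.ringKrullDim_eq_height p.asIdeal]
    exact WithBot.coe_le_coe.2 (hc p.asIdeal hp)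
  · nontriviality A
    have hmon : (X ^ N * f ^ d).Monic := (monic_X_pow N).mul (hf.pow d)
    have := hmon.add_of_left (q := ∑ i, algebraMap k A[X] (c i) * ι x i) ?_
    · simpa [hx] using this
    · refine (degree_sum_le _ _).trans_lt ?_
      rw [Finset.sup_lt_iff (by simp [hmon.ne_zero, bot_lt_iff_ne_bot])]
      intro i _
      rw [Polynomial.algebraMap_apply, ← smul_eq_C_mul]
      refine (degree_smul_le _ _).trans_lt ((hN i).trans_le ?_)
      rw [(hf.pow d).degree_mul, degree_X_pow]
      exact le_add_of_nonneg_right (zero_le_degree_iff.2 (hf.pow d).ne_zero)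
end

section
/- Let R be a commutative ring and Q a finitely generated projective R-module. Let (α(T), f(T)) : Q[T] ⊕ R[T] ↠ R[T] be a surjective R[T]-linear map with f(T) a monic polynomial. Then there exists an automorphism σ(T) of Q[T] ⊕ R[T] which is isotopic to the identity and satisfies pr₂ ∘ σ(T) = (α(T), f(T)), where pr₂ : Q[T] ⊕ R[T] → R[T] is the second projection. -/
open TensorProduct

universe u

/-- An endomorphism `1 + ∑ nᵢⱼ Φⱼ • Eᵢ` with `Φᵢ Eⱼ = s δᵢⱼ` and `det (1 + s n) = 1`
is invertible. -/
noncomputable def rankTwoEquiv {B N : Type*} [CommRing B] [AddCommGroup N] [Module B N]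
    {Φ₁ Φ₂ : N →ₗ[B] B} {E₁ E₂ : N} {s : B} (h₁₁ : Φ₁ E₁ = s) (h₁₂ : Φ₁ E₂ = 0)
    (h₂₁ : Φ₂ E₁ = 0) (h₂₂ : Φ₂ E₂ = s) {n₁₁ n₁₂ n₂₁ n₂₂ : B}
    (hn : n₁₁ + n₂₂ + s * (n₁₁ * n₂₂ - n₁₂ * n₂₁) = 0) : N ≃ₗ[B] N :=
  LinearEquiv.ofLinearMap
    (LinearMap.id + (n₁₁ • Φ₁ + n₁₂ • Φ₂).smulRight E₁ + (n₂₁ • Φ₁ + n₂₂ • Φ₂).smulRight E₂)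
    (LinearMap.id + (n₂₂ • Φ₁ - n₁₂ • Φ₂).smulRight E₁ + (n₁₁ • Φ₂ - n₂₁ • Φ₁).smulRight E₂)
    (by
      ext x
      simp only [LinearMap.coe_comp, Function.comp_apply, LinearMap.add_apply, LinearMap.sub_apply,
        LinearMap.smul_apply, LinearMap.smulRight_apply, LinearMap.id_apply, map_add, map_smul,
        smul_eq_mul, h₁₁, h₁₂, h₂₁, h₂₂]
      linear_combination (norm := module) (hn * Φ₁ x) • E₁ + (hn * Φ₂ x) • E₂)
    (by
      ext x
      simp only [LinearMap.coe_comp, Function.comp_apply, LinearMap.add_apply, LinearMap.sub_apply,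
        LinearMap.smul_apply, LinearMap.smulRight_apply, LinearMap.id_apply, map_add, map_smul,
        smul_eq_mul, h₁₁, h₁₂, h₂₁, h₂₂]
      linear_combination (norm := module) (hn * Φ₁ x) • E₁ + (hn * Φ₂ x) • E₂)

theorem exists_equiv_comp_eq {B N : Type*} [CommRing B] [AddCommGroup N] [Module B N]
    {V V' η Φ₁ Φ₂ : N →ₗ[B] B} {E₁ E₂ : N} {s c z h₁ h₂ k₁ k₂ : B}
    (hV' : ∀ x, V' x = V x + s * c * z * η x)
    (h₁₁ : Φ₁ E₁ = s) (h₁₂ : Φ₁ E₂ = 0) (h₂₁ : Φ₂ E₁ = 0) (h₂₂ : Φ₂ E₂ = s)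
    (hc : h₁ * V E₁ + h₂ * V E₂ = c)
    (hk : η E₁ * h₁ + η E₂ * h₂ + V E₁ * k₁ + V E₂ * k₂
      + s * c * z * (η E₁ * k₁ + η E₂ * k₂) = 0) :
    ∃ Ψ : N ≃ₗ[B] N, ∀ x, V' x = V (Ψ x) := by
  let g : Module.Dual B N :=
    z • (η ∘ₗ (s • LinearMap.id - Φ₁.smulRight E₁ - Φ₂.smulRight E₂))
  have hg : g (h₁ • E₁ + h₂ • E₂) = 0 := by
    simp [g, h₁₁, h₁₂, h₂₁, h₂₂]
    ring
  have hn : z * (h₁ * η E₁ + V E₂ * k₂) + z * (h₂ * η E₂ + V E₁ * k₁)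
      + s * (z * (h₁ * η E₁ + V E₂ * k₂) * (z * (h₂ * η E₂ + V E₁ * k₁))
        - z * (h₁ * η E₂ - V E₂ * k₁) * (z * (h₂ * η E₁ - V E₁ * k₂))) = 0 := by
    linear_combination z * hk + s * z ^ 2 * (η E₁ * k₁ + η E₂ * k₂) * hc
  refine ⟨(rankTwoEquiv h₁₁ h₁₂ h₂₁ h₂₂ hn).trans (LinearEquiv.transvection hg), fun x ↦ ?_⟩
  simp only [rankTwoEquiv, LinearEquiv.trans_apply, LinearEquiv.coe_ofLinearMap, hV',
    LinearEquiv.transvection.apply, g, LinearMap.coe_comp, Function.comp_apply,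
    LinearMap.add_apply, LinearMap.sub_apply,
    LinearMap.smul_apply, LinearMap.smulRight_apply, LinearMap.id_apply, map_add, map_sub, map_smul,
    smul_eq_mul, h₁₁, h₁₂, h₂₁, h₂₂]
  subst hc
  ring

/-- The value at `X = b` of a functional with polynomial coefficients. -/
noncomputable def rowAt {S M : Type*} [CommRing S] [AddCommGroup M] [Module S M]
    (v : M →ₗ[S] Polynomial S) {B : Type*} [CommRing B] [Algebra S B] (b : B) :
    (B ⊗[S] M) →ₗ[B] B :=
  ((Polynomial.aeval b).toLinearMap ∘ₗ v).liftBaseChange B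

@[simp]
theorem rowAt_tmul {S M : Type*} [CommRing S] [AddCommGroup M] [Module S M]
    (v : M →ₗ[S] Polynomial S) {B : Type*} [CommRing B] [Algebra S B] (b t : B) (x : M) :
    rowAt v b (t ⊗ₜ[S] x) = t * Polynomial.aeval b (v x) := by
  simp [rowAt]

/-- The values of `v` at `b` and `b'` differ by an automorphism. -/
def RowConj {S M : Type*} [CommRing S] [AddCommGroup M] [Module S M]
    (v : M →ₗ[S] Polynomial S) {B : Type*} [CommRing B] [Algebra S B] (b b' : B) : Prop :=
  ∃ Ψ : (B ⊗[S] M) ≃ₗ[B] (B ⊗[S] M), ∀ x, rowAt v b' x = rowAt v b (Ψ x)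

theorem RowConj.trans {S M : Type*} [CommRing S] [AddCommGroup M] [Module S M]
    {v : M →ₗ[S] Polynomial S} {B : Type*} [CommRing B] [Algebra S B] {b b' b'' : B}
    (h : RowConj v b b') (h' : RowConj v b' b'') : RowConj v b b'' := by
  obtain ⟨Ψ, hΨ⟩ := h
  obtain ⟨Ψ', hΨ'⟩ := h'
  exact ⟨Ψ'.trans Ψ, fun x ↦ by simp [hΨ, hΨ']⟩

/-- The ideal of all `c` such that moving the argument of `v` by multiples of `c` does not change
the orbit of the value of `v`. -/
def rowIdeal {S : Type u} {M : Type*} [CommRing S] [AddCommGroup M] [Module S M]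
    (v : M →ₗ[S] Polynomial S) : Ideal S where
  carrier := {c | ∀ (B : Type u) [CommRing B] [Algebra S B] (b z : B),
    RowConj v b (b + algebraMap S B c * z)}
  add_mem' {c c'} h h' B _ _ b z := by
    rw [map_add, add_mul, ← add_assoc]
    exact (h B b z).trans (h' B _ z)
  zero_mem' B _ _ b z := ⟨LinearEquiv.refl B _, fun x ↦ by simp⟩
  smul_mem' r c h B _ _ b z := by
    have := h B b (algebraMap S B r * z)
    rwa [smul_eq_mul, map_mul, mul_comm (algebraMap S B r), mul_assoc]

/-- The divided difference of a polynomial, as a polynomial `d` in two variables with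
`p (b + y) = p b + y * d (b, y)`. -/
noncomputable def divDiff (S : Type*) [CommRing S] :
    Polynomial S →ₗ[S] Polynomial (Polynomial S) where
  toFun p := (Polynomial.aeval (Polynomial.X + Polynomial.C Polynomial.X) p).divX
  map_add' p q := by
    ext n : 1
    simp [Polynomial.coeff_divX]
  map_smul' r p := by
    ext n : 1
    simp [Polynomial.coeff_divX]

theorem aeval_X_add_C_X {S : Type*} [CommRing S] (p : Polynomial S) :
    Polynomial.aeval (Polynomial.X + Polynomial.C Polynomial.X : Polynomial (Polynomial S)) p =
      Polynomial.C p + Polynomial.X * divDiff S p := by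
  rw [divDiff, LinearMap.coe_mk, AddHom.coe_mk]
  have h : Polynomial.coeff (Polynomial.aeval
      (Polynomial.X + Polynomial.C Polynomial.X : Polynomial (Polynomial S)) p) 0 = p := by
    have := Polynomial.aeval_algHom_apply
      ((Polynomial.aeval (0 : Polynomial S)).restrictScalars S)
      (Polynomial.X + Polynomial.C Polynomial.X : Polynomial (Polynomial S)) p
    rw [Polynomial.coeff_zero_eq_aeval_zero]
    simpa using this.symm
  conv_lhs => rw [← Polynomial.X_mul_divX_add (Polynomial.aeval _ p), h, add_comm]

theorem divDiff_relation {S : Type*} [CommRing S] {p₁ p₂ h₁ h₂ : Polynomial S} {c : S}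
    (h : h₁ * p₁ + h₂ * p₂ = Polynomial.C c) :
    divDiff S p₁ * Polynomial.C h₁ + divDiff S p₂ * Polynomial.C h₂
      + Polynomial.C p₁ * divDiff S h₁ + Polynomial.C p₂ * divDiff S h₂
      + Polynomial.X * (divDiff S p₁ * divDiff S h₁ + divDiff S p₂ * divDiff S h₂) = 0 := by
  have h' := congrArg (Polynomial.aeval
    (Polynomial.X + Polynomial.C Polynomial.X : Polynomial (Polynomial S))) h
  simp only [map_add, map_mul, aeval_X_add_C_X, Polynomial.aeval_C] at h'
  have h'' := congrArg (Polynomial.C : Polynomial S → Polynomial (Polynomial S)) h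
  simp only [map_add, map_mul] at h''
  have e : algebraMap S (Polynomial (Polynomial S)) c = Polynomial.C (Polynomial.C c) := rfl
  refine Polynomial.isRegular_X.left ?_
  simp only [mul_zero]
  rw [e] at h'
  linear_combination h' - h''

theorem mul_mem_rowIdeal {S : Type u} {M : Type*} [CommRing S] [AddCommGroup M] [Module S M]
    {v : M →ₗ[S] Polynomial S} {φ₁ φ₂ : M →ₗ[S] S} {e₁ e₂ : M} {s c : S}
    (h₁₁ : φ₁ e₁ = s) (h₁₂ : φ₁ e₂ = 0) (h₂₁ : φ₂ e₁ = 0) (h₂₂ : φ₂ e₂ = s)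
    {h₁ h₂ : Polynomial S} (hc : h₁ * v e₁ + h₂ * v e₂ = Polynomial.C c) :
    s * c ∈ rowIdeal v := by
  intro B _ _ b z
  let ev : Polynomial (Polynomial S) →ₐ[S] B := Polynomial.aevalTower (Polynomial.aeval b)
    (algebraMap S B (s * c) * z)
  have evX : ev Polynomial.X = algebraMap S B (s * c) * z := by simp [ev]
  have evC (p : Polynomial S) : ev (Polynomial.C p) = Polynomial.aeval b p := by simp [ev]
  have key (p : Polynomial S) : Polynomial.aeval (b + algebraMap S B (s * c) * z) p =
      Polynomial.aeval b p + algebraMap S B (s * c) * z * ev (divDiff S p) := by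
    have := congrArg ev (aeval_X_add_C_X p)
    rwa [← Polynomial.aeval_algHom_apply, map_add, map_add, map_mul, evX, evC, evC,
      Polynomial.aeval_X, add_comm _ b] at this
  have rel := congrArg ev (divDiff_relation hc)
  have hc' := congrArg (Polynomial.aeval b) hc
  simp only [map_add, map_mul, evX, evC, map_zero, Polynomial.aeval_C] at rel hc'
  have base (φ : M →ₗ[S] S) (x : M) (t : S) (h : φ x = t) :
      ((Algebra.linearMap S B) ∘ₗ φ).liftBaseChange B ((1 : B) ⊗ₜ[S] x) = algebraMap S B t := by
    simp [h]
  refine exists_equiv_comp_eq (s := algebraMap S B s) (c := algebraMap S B c) (z := z)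
    (η := (ev.toLinearMap ∘ₗ divDiff S ∘ₗ v).liftBaseChange B)
    (fun x ↦ ?_) (base φ₁ e₁ s h₁₁) (by simpa using base φ₁ e₂ 0 h₁₂)
    (by simpa using base φ₂ e₁ 0 h₂₁) (base φ₂ e₂ s h₂₂)
    (h₁ := Polynomial.aeval b h₁) (h₂ := Polynomial.aeval b h₂)
    (k₁ := ev (divDiff S h₁)) (k₂ := ev (divDiff S h₂)) ?_ ?_
  · induction x with
    | zero => simp
    | tmul t x =>
      rw [rowAt_tmul, rowAt_tmul, key]
      simp
      ring
    | add x y hx hy =>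
      simp only [map_add, hx, hy]
      ring
  · simpa using hc'
  · simpa using rel

theorem exists_rowAt_add_smul {S M : Type*} [CommRing S] [AddCommGroup M] [Module S M]
    (v : M →ₗ[S] Polynomial S) (φ : M →ₗ[S] S) {y : Polynomial S}
    (hy : y ∈ Ideal.span (v '' {x | φ x = 0})) {B : Type*} [CommRing B] [Algebra S B] (b : B) :
    ∃ E : (B ⊗[S] M) ≃ₗ[B] (B ⊗[S] M),
      ∀ x, rowAt (v + φ.smulRight y) b x = rowAt v b (E x) := by
  let φB : Module.Dual B (B ⊗[S] M) := (Algebra.linearMap S B ∘ₗ φ).liftBaseChange B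
  obtain ⟨Y, hvY, hφY⟩ : ∃ Y, rowAt v b Y = Polynomial.aeval b y ∧ φB Y = 0 := by
    induction hy using Submodule.span_induction with
    | mem p hp =>
      obtain ⟨x, hx, rfl⟩ := hp
      exact ⟨1 ⊗ₜ x, by simp, by simp [φB, show φ x = 0 from hx]⟩
    | zero => exact ⟨0, by simp, by simp⟩
    | add p q _ _ hp hq =>
      obtain ⟨Y, h₁, h₂⟩ := hp
      obtain ⟨Z, h₃, h₄⟩ := hq
      exact ⟨Y + Z, by simp [h₁, h₃], by simp [h₂, h₄]⟩
    | smul r p _ hp =>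
      obtain ⟨Y, h₁, h₂⟩ := hp
      exact ⟨Polynomial.aeval b r • Y, by simp [h₁], by simp [h₂]⟩
  refine ⟨LinearEquiv.transvection hφY, fun x ↦ ?_⟩
  rw [LinearEquiv.transvection.apply, map_add, map_smul, hvY]
  induction x with
  | zero => simp
  | tmul t x =>
    simp [φB, Algebra.smul_def]
    ring
  | add x y hx hy =>
    simp only [map_add, hx, hy, add_smul]
    abel

theorem rowIdeal_add_smul_le {S : Type u} {M : Type*} [CommRing S] [AddCommGroup M] [Module S M]
    (v : M →ₗ[S] Polynomial S) (φ : M →ₗ[S] S) {y : Polynomial S}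
    (hy : y ∈ Ideal.span (v '' {x | φ x = 0})) :
    rowIdeal (v + φ.smulRight y) ≤ rowIdeal v := by
  intro c hc B _ _ b z
  obtain ⟨Ψ, hΨ⟩ := hc B b z
  obtain ⟨E, hE⟩ := exists_rowAt_add_smul v φ hy b
  obtain ⟨E', hE'⟩ := exists_rowAt_add_smul v φ hy (b + algebraMap S B c * z)
  refine ⟨E'.symm.trans (Ψ.trans E), fun x ↦ ?_⟩
  rw [LinearEquiv.trans_apply, LinearEquiv.trans_apply, ← hE, ← hΨ, hE',
    LinearEquiv.apply_symm_apply]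

theorem exists_mem_isCoprime_add {A : Type*} [CommRing A] [IsDomain A] [IsPrincipalIdealRing A]
    {a f : A} (hf : f ≠ 0) {I : Ideal A} (h : Ideal.span {a, f} ⊔ I = ⊤) :
    ∃ y ∈ I, IsCoprime (a + y) f := by
  classical
  obtain ⟨w, hw, g, hg, hwg⟩ := Submodule.mem_sup.1 ((Ideal.eq_top_iff_one _).1 h)
  obtain ⟨u₁, u₂, rfl⟩ := Ideal.mem_span_pair.1 hw
  let F := UniqueFactorizationMonoid.factors f
  let t := (F.filter fun p ↦ ¬ p ∣ a).prod
  have hF (p : A) (hp : p ∈ F) : Prime p := UniqueFactorizationMonoid.prime_of_factor p hp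
  refine ⟨t * g, I.mul_mem_left t hg, isCoprime_of_prime_dvd (by simp [hf]) fun P hP hPa hPf ↦ ?_⟩
  by_cases ha : P ∣ a
  · rcases hP.dvd_or_dvd ((dvd_add_right ha).1 hPa) with ht | hPg
    · obtain ⟨p, hp, hPp⟩ := hP.exists_mem_multiset_dvd ht
      obtain ⟨hpF, hpa⟩ := Multiset.mem_filter.1 hp
      exact hpa ((hP.associated_of_dvd (hF p hpF) hPp).symm.dvd.trans ha)
    · apply hP.not_isUnit
      rw [isUnit_iff_dvd_one, ← hwg]
      exact dvd_add (dvd_add (ha.mul_left _) (hPf.mul_left _)) hPg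
  · obtain ⟨p, hp, hPp⟩ := UniqueFactorizationMonoid.exists_mem_factors_of_dvd hf hP.irreducible hPf
    have hpt : p ∣ t := Multiset.dvd_prod
      (Multiset.mem_filter.2 ⟨hp, fun h ↦ ha (hPp.dvd.trans h)⟩)
    exact ha ((dvd_add_left ((hPp.dvd.trans hpt).mul_right g)).1 hPa)

theorem exists_mul_add_mul_eq_C_notMem {S : Type*} [CommRing S] (m : Ideal S) [hm : m.IsPrime]
    {a f : Polynomial S} (hf : f.Monic)
    (h : IsCoprime (a.map (Ideal.Quotient.mk m)) (f.map (Ideal.Quotient.mk m))) :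
    ∃ c ∉ m, ∃ h₁ h₂ : Polynomial S, h₁ * a + h₂ * f = Polynomial.C c := by
  have := hf.finite_adjoinRoot
  let I : Ideal (AdjoinRoot f) := Ideal.span {AdjoinRoot.mk f a}
  have hI : ¬ I.comap (algebraMap S (AdjoinRoot f)) ≤ m := by
    intro hle
    obtain ⟨𝔮, hI𝔮, h𝔮, h𝔮m⟩ := Ideal.exists_ideal_over_prime_of_isIntegral m I hle
    obtain ⟨u, w, huw⟩ := h
    obtain ⟨u, rfl⟩ := Polynomial.map_surjective _ Ideal.Quotient.mk_surjective u
    obtain ⟨w, rfl⟩ := Polynomial.map_surjective _ Ideal.Quotient.mk_surjective w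
    have hker : u * a + w * f - 1 ∈ RingHom.ker (Polynomial.mapRingHom (Ideal.Quotient.mk m)) := by
      simp [RingHom.mem_ker, huw]
    rw [Polynomial.ker_mapRingHom, Ideal.mk_ker] at hker
    have hle : m.map Polynomial.C ≤ 𝔮.comap (AdjoinRoot.mk f) := by
      rw [Ideal.map_le_iff_le_comap, ← h𝔮m]
      exact fun x hx ↦ hx
    have h1 : AdjoinRoot.mk f (u * a + w * f - 1) ∈ 𝔮 := hle hker
    have h2 : AdjoinRoot.mk f a ∈ 𝔮 := hI𝔮 (Ideal.mem_span_singleton_self _)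
    rw [map_sub, map_add, map_mul, map_mul, AdjoinRoot.mk_self, mul_zero, add_zero, map_one] at h1
    exact h𝔮.ne_top ((Ideal.eq_top_iff_one _).2
      ((Submodule.sub_mem_iff_right _ (𝔮.mul_mem_left _ h2)).1 h1))
  obtain ⟨c, hc, hcm⟩ := Set.not_subset.1 hI
  obtain ⟨d, hd⟩ := Ideal.mem_span_singleton'.1 (show algebraMap S (AdjoinRoot f) c ∈ I from hc)
  obtain ⟨d, rfl⟩ := AdjoinRoot.mk_surjective d
  have hd' : AdjoinRoot.mk f (Polynomial.C c) = AdjoinRoot.mk f (d * a) := by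
    rw [map_mul, hd]; rfl
  obtain ⟨e, he⟩ := AdjoinRoot.mk_eq_mk.1 hd'
  exact ⟨c, hcm, d, e, by linear_combination -he⟩

theorem exists_dual_apply_notMem {S P : Type*} [CommRing S] [AddCommGroup P] [Module S P]
    [Module.Projective S P] {m : Ideal S} {v : P →ₗ[S] Polynomial S} {x : P}
    (hx : v x ∉ m.map Polynomial.C) : ∃ (φ : P →ₗ[S] S) (e : P), φ e ∉ m := by
  by_contra! H
  obtain ⟨s, hs⟩ := Module.projective_def'.1 (inferInstance : Module.Projective S P)
  have hsx := LinearMap.congr_fun hs x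
  apply hx
  rw [LinearMap.id_apply, LinearMap.comp_apply, Finsupp.linearCombination_apply] at hsx
  rw [← hsx, Finsupp.sum, map_sum]
  refine Ideal.sum_mem _ fun p _ ↦ ?_
  rw [map_smul, Polynomial.smul_eq_C_mul]
  exact Ideal.mul_mem_right _ _ (Ideal.mem_map_of_mem _ (H (Finsupp.lapply p ∘ₗ s) x))

theorem rowIdeal_eq_top_of_apply_eq_one {S : Type u} {M : Type*} [CommRing S] [AddCommGroup M]
    [Module S M] {v : M →ₗ[S] Polynomial S} {e : M} (he : v e = 1) : rowIdeal v = ⊤ := by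
  refine (Ideal.eq_top_iff_one _).2 fun B _ _ b z ↦ ?_
  let b' := b + algebraMap S B 1 * z
  have h : (rowAt v b' - rowAt v b : Module.Dual B (B ⊗[S] M)) (1 ⊗ₜ e) = 0 := by simp [he]
  refine ⟨LinearEquiv.transvection h, fun x ↦ ?_⟩
  rw [LinearEquiv.transvection.apply]
  simp [he, b']

theorem isUnit_of_span_range_eq_top {A M : Type*} {S : Type*} [CommRing S] [CommRing A]
    [AddCommGroup M] [Module S M] {v : M × S →ₗ[S] Polynomial S} (ρ : Polynomial S →+* A)
    (hv : Ideal.span (Set.range v) = ⊤) (h : ∀ x, ρ (v (x, 0)) = 0) : IsUnit (ρ (v (0, 1))) := by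
  rw [← Ideal.span_singleton_eq_top, eq_top_iff, ← Ideal.map_top ρ, ← hv, Ideal.map_span,
    Ideal.span_le]
  rintro _ ⟨_, ⟨⟨x, g⟩, rfl⟩, rfl⟩
  have hx : (x, g) = (x, (0 : S)) + g • ((0 : M), (1 : S)) := by simp
  rw [hx, map_add, map_add, h, zero_add, map_smul, Polynomial.smul_eq_C_mul, map_mul]
  exact Ideal.mul_mem_left _ _ (Ideal.mem_span_singleton_self _)

theorem rowIdeal_eq_top {S : Type u} {P : Type*} [CommRing S] [AddCommGroup P] [Module S P]
    [Module.Projective S P] (v : P × S →ₗ[S] Polynomial S) (hf : (v (0, 1)).Monic)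
    (hv : Ideal.span (Set.range v) = ⊤) : rowIdeal v = ⊤ := by
  by_contra hne
  obtain ⟨m, hm, hle⟩ := Ideal.exists_le_maximal _ hne
  let _ := Ideal.Quotient.field m
  let ρ : Polynomial S →+* Polynomial (S ⧸ m) := Polynomial.mapRingHom (Ideal.Quotient.mk m)
  have hρ : Function.Surjective ρ := Polynomial.map_surjective _ Ideal.Quotient.mk_surjective
  have hker : RingHom.ker ρ = m.map Polynomial.C := by
    rw [Polynomial.ker_mapRingHom, Ideal.mk_ker]
  by_cases hall : ∀ x, ρ (v (x, 0)) = 0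
  · have hu := isUnit_of_span_range_eq_top ρ hv hall
    refine hne (rowIdeal_eq_top_of_apply_eq_one (e := (0, 1)) ?_)
    rw [← hf.natDegree_eq_zero, ← hf.natDegree_map (Ideal.Quotient.mk m)]
    exact Polynomial.natDegree_eq_zero_of_isUnit hu
  obtain ⟨x₀, hx₀⟩ := not_forall.1 hall
  obtain ⟨φ₀, e₀, hs⟩ := exists_dual_apply_notMem (m := m) (v := v ∘ₗ LinearMap.inl S P S)
    (x := x₀) (by rwa [← hker])
  let φ : P × S →ₗ[S] S := φ₀ ∘ₗ LinearMap.fst S P S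
  let e : P × S := (e₀, 0)
  let s : S := φ₀ e₀
  let I := Ideal.span (v '' {x | φ x = 0})
  have hsk : Ideal.Quotient.mk m s ≠ 0 := by rwa [Ne, Ideal.Quotient.eq_zero_iff_mem]
  let t : Polynomial (S ⧸ m) := Polynomial.C (Ideal.Quotient.mk m s)⁻¹
  have ht : t * ρ (Polynomial.C s) = 1 := by
    simp only [t, ρ, Polynomial.coe_mapRingHom, Polynomial.map_C, ← Polynomial.C_mul]
    rw [inv_mul_cancel₀ hsk, Polynomial.C_1]
  have htop : Ideal.span {ρ (v e), ρ (v (0, 1))} ⊔ I.map ρ = ⊤ := by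
    rw [eq_top_iff, ← Ideal.map_top ρ, ← hv, Ideal.map_span, Ideal.span_le]
    rintro _ ⟨_, ⟨x, rfl⟩, rfl⟩
    have hx : Polynomial.C s * v x = Polynomial.C (φ x) * v e + v (s • x - φ x • e) := by
      rw [← Polynomial.smul_eq_C_mul, ← Polynomial.smul_eq_C_mul, ← map_smul, ← map_smul,
        ← map_add, add_sub_cancel]
    have hx' : ρ (v x) = t * (ρ (Polynomial.C (φ x)) * ρ (v e) + ρ (v (s • x - φ x • e))) := by
      rw [← map_mul, ← map_add, ← hx, map_mul, ← mul_assoc, ht, one_mul]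
    rw [hx']
    refine Ideal.mul_mem_left _ _ (Submodule.add_mem_sup
      (Ideal.mul_mem_left _ _ (Ideal.subset_span (by simp)))
      (Ideal.mem_map_of_mem _ (Ideal.subset_span ⟨_, ?_, rfl⟩)))
    simp only [Set.mem_ofPred_eq, map_sub, map_smul, smul_eq_mul]
    exact sub_eq_zero.2 (mul_comm _ _)
  obtain ⟨y', hy', hcop⟩ := exists_mem_isCoprime_add (hf.map (Ideal.Quotient.mk m)).ne_zero htop
  obtain ⟨y, hy, hyy'⟩ := (Ideal.mem_map_iff_of_surjective ρ hρ).1 ((I.map ρ).mul_mem_left t hy')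
  let v₂ := v + φ.smulRight y
  have h₂ : v₂ (0, 1) = v (0, 1) := by simp [v₂, φ]
  have h₁ : ρ (v₂ e) = ρ (v e) + y' := by
    have : v₂ e = v e + Polynomial.C s * y := by
      simp [v₂, φ, e, s, Polynomial.smul_eq_C_mul]
    rw [this, map_add, map_mul, hyy', ← mul_assoc, mul_comm _ t, ht, one_mul]
  obtain ⟨c, hc, k₁, k₂, hk⟩ := exists_mul_add_mul_eq_C_notMem m (a := v₂ e) hf (by
    change IsCoprime (ρ (v₂ e)) _
    rw [h₁]; exact hcop)
  have hmem : s * c ∈ rowIdeal v₂ := mul_mem_rowIdeal (φ₁ := φ) (φ₂ := s • LinearMap.snd S P S)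
    (e₁ := e) (e₂ := (0, 1)) rfl (by simp [φ]) (by simp [e]) (by simp) (by rw [h₂]; exact hk)
  exact (hm.isPrime.mem_or_mem (hle (rowIdeal_add_smul_le v φ hy hmem))).elim hs hc

/-- The homogenization of degree `n` of a polynomial, evaluated at `(x, w)`. -/
noncomputable def homogEval {R A : Type*} [CommRing R] [CommRing A] [Algebra R A] (n : ℕ)
    (x w : A) : Polynomial R →ₗ[R] A :=
  ∑ j ∈ Finset.range (n + 1), (Polynomial.lcoeff R j).smulRight (x ^ j * w ^ (n - j))

theorem homogEval_apply {R A : Type*} [CommRing R] [CommRing A] [Algebra R A] (n : ℕ)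
    (x w : A) (g : Polynomial R) :
    homogEval n x w g = ∑ j ∈ Finset.range (n + 1), g.coeff j • (x ^ j * w ^ (n - j)) := by
  simp [homogEval]

theorem map_homogEval {R A A' : Type*} [CommRing R] [CommRing A] [Algebra R A] [CommRing A']
    [Algebra R A'] (ψ : A →ₐ[R] A') (n : ℕ) (x w : A) (g : Polynomial R) :
    ψ (homogEval n x w g) = homogEval n (ψ x) (ψ w) g := by
  simp [homogEval_apply]

theorem homogEval_mul_self {R A : Type*} [CommRing R] [CommRing A] [Algebra R A] {n : ℕ}
    (x w : A) {g : Polynomial R} (hg : g.natDegree ≤ n) :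
    homogEval n (w * x) w g = w ^ n * Polynomial.aeval x g := by
  rw [homogEval_apply, Polynomial.aeval_eq_sum_range' (Nat.lt_succ_of_le hg), Finset.mul_sum]
  refine Finset.sum_congr rfl fun j hj ↦ ?_
  rw [mul_smul_comm, mul_pow, ← pow_mul_pow_sub w (Finset.mem_range_succ_iff.1 hj)]
  congr 1
  ring

theorem homogEval_zero_right {R A : Type*} [CommRing R] [CommRing A] [Algebra R A] (n : ℕ)
    (x : A) (g : Polynomial R) : homogEval n x 0 g = g.coeff n • x ^ n := by
  rw [homogEval_apply, Finset.sum_range_succ, Finset.sum_eq_zero, zero_add]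
  · simp
  · intro j hj
    rw [zero_pow (Nat.sub_ne_zero_of_lt (Finset.mem_range.1 hj)), mul_zero, smul_zero]

theorem monic_homogEval {R S : Type*} [CommRing R] [CommRing S] [Algebra R S]
    {x : Polynomial S} (hx : x.Monic) (hx2 : x.natDegree = 2) {f : Polynomial R} (hf : f.Monic) :
    (homogEval f.natDegree x Polynomial.X f).Monic := by
  nontriviality S
  rw [homogEval_apply, Finset.sum_range_succ, add_comm, hf.coeff_natDegree, one_smul, Nat.sub_self,
    pow_zero, mul_one]
  refine (hx.pow _).add_of_left ?_
  rw [Polynomial.degree_eq_natDegree (hx.pow _).ne_zero, hx.natDegree_pow, hx2]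
  refine (Polynomial.degree_sum_le _ _).trans_lt ?_
  rw [Finset.sup_lt_iff (WithBot.bot_lt_coe _)]
  intro j hj
  have hj := Finset.mem_range.1 hj
  refine (Polynomial.degree_smul_le _ _).trans_lt ?_
  refine Polynomial.degree_le_natDegree.trans_lt ?_
  rw [Nat.cast_lt, (hx.pow j).natDegree_mul (Polynomial.monic_X_pow _), hx.natDegree_pow, hx2,
    Polynomial.natDegree_X_pow]
  omega

theorem exists_equiv_evalTensor {S M : Type*} [CommRing S] [AddCommGroup M] [Module S M]
    (Φ : (Polynomial S ⊗[S] M) ≃ₗ[Polynomial S] (Polynomial S ⊗[S] M)) (c : S) :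
    ∃ σ : M ≃ₗ[S] M, ∀ z, evalTensor S M c (Φ z) = σ (evalTensor S M c z) := by
  have hsmul (p : Polynomial S) (z : Polynomial S ⊗[S] M) :
      evalTensor S M c (p • z) = p.eval c • evalTensor S M c z := by
    induction z with
    | zero => simp
    | tmul t x =>
      rw [TensorProduct.smul_tmul', smul_eq_mul]
      simp [evalTensor, mul_smul]
    | add x y hx hy => simp only [smul_add, map_add, hx, hy]
  have h1 (x : M) : evalTensor S M c (1 ⊗ₜ x) = x := by simp [evalTensor]
  let g (Φ : (Polynomial S ⊗[S] M) ≃ₗ[Polynomial S] (Polynomial S ⊗[S] M)) : M →ₗ[S] M :=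
    evalTensor S M c ∘ₗ (Φ.toLinearMap.restrictScalars S) ∘ₗ TensorProduct.mk S _ M 1
  have hg (Φ : (Polynomial S ⊗[S] M) ≃ₗ[Polynomial S] (Polynomial S ⊗[S] M))
      (z : Polynomial S ⊗[S] M) : evalTensor S M c (Φ z) = g Φ (evalTensor S M c z) := by
    induction z with
    | zero => simp
    | tmul t x =>
      have : t ⊗ₜ[S] x = t • ((1 : Polynomial S) ⊗ₜ[S] x) := by simp [TensorProduct.smul_tmul']
      rw [this, map_smul, hsmul, hsmul, map_smul, h1]
      rfl
    | add x y hx hy => simp only [map_add, hx, hy]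
  refine ⟨LinearEquiv.ofLinearMap (g Φ) (g Φ.symm) ?_ ?_, hg Φ⟩
  · ext x
    change g Φ (evalTensor S M c (Φ.symm (1 ⊗ₜ x))) = x
    rw [← hg, LinearEquiv.apply_symm_apply, h1]
  · ext x
    change g Φ.symm (evalTensor S M c (Φ (1 ⊗ₜ x))) = x
    rw [← hg, LinearEquiv.symm_apply_apply, h1]

/-- A monic unimodular row of polynomials starting at `pr₂` ends at `pr₂ ∘ σ`, with `σ` isotopic
to the identity. -/
theorem exists_isotopicToId_of_monic {S : Type u} {P : Type*} [CommRing S] [AddCommGroup P]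
    [Module S P] [Module.Projective S P] (v : P × S →ₗ[S] Polynomial S)
    (hf : (v (0, 1)).Monic) (hv : Ideal.span (Set.range v) = ⊤)
    (h0 : ∀ x, (v x).eval 0 = x.2) :
    ∃ σ : (P × S) ≃ₗ[S] (P × S), IsotopicToId σ ∧ ∀ x, (σ x).2 = (v x).eval 1 := by
  obtain ⟨Ψ, hΨ⟩ : RowConj v (0 : Polynomial S) Polynomial.X := by
    have h : (1 : S) ∈ rowIdeal v := by rw [rowIdeal_eq_top v hf hv]; trivial
    simpa using h (Polynomial S) 0 Polynomial.X
  have heval (c : S) (z : Polynomial S ⊗[S] (P × S)) :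
      (evalTensor S (P × S) c z).2 = (rowAt v (0 : Polynomial S) z).eval c := by
    induction z with
    | zero => simp
    | tmul t x =>
      have : Polynomial.aeval (0 : Polynomial S) (v x) = Polynomial.C x.2 := by
        rw [← h0, ← Polynomial.coeff_zero_eq_aeval_zero']
        simp [Polynomial.coeff_zero_eq_eval_zero]
      simp [evalTensor, this, Polynomial.aeval_def]
    | add x y hx hy => simp [hx, hy]
  have hX (x : P × S) : rowAt v (Polynomial.X : Polynomial S) (1 ⊗ₜ x) = v x := by simp
  obtain ⟨σ₀, hσ₀⟩ := exists_equiv_evalTensor Ψ 0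
  obtain ⟨σ₁, hσ₁⟩ := exists_equiv_evalTensor Ψ 1
  have h1 (c : S) (x : P × S) : evalTensor S (P × S) c (1 ⊗ₜ x) = x := by simp [evalTensor]
  have h2 (x : P × S) : (σ₀ x).2 = x.2 := by
    rw [← h1 0 x, ← hσ₀, heval, ← hΨ, hX, h0, h1]
  have hbc (c : S) (z : Polynomial S ⊗[S] (P × S)) : evalTensor S (P × S) c
      (σ₀.symm.baseChange S (Polynomial S) _ _ z) = σ₀.symm (evalTensor S (P × S) c z) := by
    induction z with
    | zero => simp
    | tmul t x => simp [evalTensor]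
    | add x y hx hy => simp only [map_add, hx, hy]
  refine ⟨σ₁.trans σ₀.symm, ⟨Ψ.trans (σ₀.symm.baseChange S (Polynomial S) _ _), ?_, ?_⟩, ?_⟩
  · intro x
    rw [LinearEquiv.trans_apply, hbc, hσ₀, h1, LinearEquiv.symm_apply_apply]
  · intro x
    rw [LinearEquiv.trans_apply, hbc, hσ₁, h1, LinearEquiv.trans_apply]
  · intro x
    rw [LinearEquiv.trans_apply, ← h2 (σ₀.symm _), LinearEquiv.apply_symm_apply]
    nth_rw 1 [← h1 1 x]
    rw [← hσ₁, heval, ← hΨ, hX]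

/-- Division by a monic polynomial, as a linear map. -/
noncomputable def divByMonicHom {R : Type*} [CommRing R] {f : Polynomial R} (hf : f.Monic) :
    Polynomial R →ₗ[R] Polynomial R where
  toFun p := p /ₘ f
  map_add' p q := by
    refine hf.isRegular.left ?_
    have h := Polynomial.modByMonic_add_div (p + q) f
    rw [Polynomial.add_modByMonic] at h
    have hp := Polynomial.modByMonic_add_div p f
    have hq := Polynomial.modByMonic_add_div q f
    simp only
    linear_combination h - hp - hq
  map_smul' r p := by
    refine hf.isRegular.left ?_
    have h := Polynomial.modByMonic_add_div (r • p) f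
    have hp := Polynomial.modByMonic_add_div p f
    rw [Polynomial.smul_modByMonic] at h
    simp only [RingHom.id_apply, Polynomial.smul_eq_C_mul] at h ⊢
    linear_combination h - Polynomial.C r * hp

/-- If `(α(T), f(T)) : Q[T] ⊕ R[T] ↠ R[T]` is surjective with `f` monic, there is an
automorphism `σ(T)` of `Q[T] ⊕ R[T]`, isotopic to the identity, with `pr₂ ∘ σ = (α, f)`. -/
theorem stmt5 (R : Type*) [CommRing R] [IsNoetherianRing R]
    (Q : Type*) [AddCommGroup Q] [Module R Q] [Module.Finite R Q] [Module.Projective R Q]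
    (α : (Polynomial R ⊗[R] Q) →ₗ[Polynomial R] Polynomial R)
    (f : Polynomial R) (hf : f.Monic)
    (hsurj : Function.Surjective
      (fun x : (Polynomial R ⊗[R] Q) × Polynomial R => α x.1 + f * x.2)) :
    ∃ σ : ((Polynomial R ⊗[R] Q) × Polynomial R) ≃ₗ[Polynomial R]
        ((Polynomial R ⊗[R] Q) × Polynomial R),
      IsotopicToId σ ∧ ∀ x, (σ x).2 = α x.1 + f * x.2 := by
  let S := Polynomial R
  let n := f.natDegree
  let x : Polynomial S := Polynomial.X ^ 2 + Polynomial.C (Polynomial.X - 2) * Polynomial.X + 1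
  have hx2 : x.natDegree ≤ 2 := by
    simp only [x]
    compute_degree
  have hx : x.Monic := Polynomial.monic_of_natDegree_le_of_coeff_eq_one 2 hx2 (by
    simp [x, Polynomial.coeff_one])
  have hx1 : x.eval 1 = Polynomial.X := by
    simp [x]
    ring
  let F : Polynomial S := homogEval n x Polynomial.X f
  have hev (c : S) (g : Polynomial R) :
      (homogEval n x Polynomial.X g).eval c = homogEval n (x.eval c) c g := by
    have := map_homogEval ((Polynomial.aeval c).restrictScalars R : Polynomial S →ₐ[R] S)
      n x Polynomial.X g
    simpa using this
  let αQ : Q →ₗ[R] Polynomial R := (α.restrictScalars R) ∘ₗ TensorProduct.mk R _ Q 1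
  let u : Q →ₗ[R] Polynomial S := homogEval n x Polynomial.X ∘ₗ Polynomial.modByMonicHom f ∘ₗ αQ +
    LinearMap.mulLeft R (F * Polynomial.X) ∘ₗ
      (Polynomial.CAlgHom (R := R) (A := S)).toLinearMap ∘ₗ divByMonicHom hf ∘ₗ αQ
  have hu (q : Q) : u q = homogEval n x Polynomial.X (αQ q %ₘ f) +
    F * Polynomial.X * Polynomial.C (αQ q /ₘ f) := rfl
  let v : (S ⊗[R] Q) × S →ₗ[S] Polynomial S :=
    (u.liftBaseChange S).coprod (LinearMap.toSpanSingleton S _ F)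
  have hv1 (q : Q) : v (1 ⊗ₜ q, 0) = u q := by simp [v]
  have hvF : v (0, 1) = F := by simp [v]
  have hα (q : Q) : αQ q = α (1 ⊗ₜ q) := rfl
  have hdeg (q : Q) : (αQ q %ₘ f).natDegree ≤ n :=
    Polynomial.natDegree_modByMonic_le _ hf
  have hcoeff (q : Q) : (αQ q %ₘ f).coeff n = 0 := by
    nontriviality R
    exact Polynomial.coeff_eq_zero_of_degree_lt ((Polynomial.degree_modByMonic_lt _ hf).trans_le
      Polynomial.degree_le_natDegree)
  have hF0 : F.eval 0 = 1 := by
    rw [hev, homogEval_zero_right, hf.coeff_natDegree]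
    simp [x]
  have hv0 (y : (S ⊗[R] Q) × S) : (v y).eval 0 = y.2 := by
    obtain ⟨z, g⟩ := y
    have hz : (u.liftBaseChange S z).eval 0 = 0 := by
      induction z with
      | zero => simp
      | tmul t q => simp [hu, hev, homogEval_zero_right, hcoeff]
      | add z z' h h' => simp [h, h']
    simp [v, hz, hF0]
  have hone (g : Polynomial R) (hg : g.natDegree ≤ n) :
      (homogEval n x Polynomial.X g).eval 1 = g := by
    have := homogEval_mul_self (Polynomial.X : S) 1 hg
    simpa [hev, hx1] using this
  have hv1' (y : (S ⊗[R] Q) × S) : (v y).eval 1 = α y.1 + f * y.2 := by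
    obtain ⟨z, g⟩ := y
    have hz : (u.liftBaseChange S z).eval 1 = α z := by
      induction z with
      | zero => simp
      | tmul t q =>
        have ht : t ⊗ₜ[R] q = t • ((1 : S) ⊗ₜ[R] q) := by simp [TensorProduct.smul_tmul']
        rw [ht, map_smul, map_smul, ← hα, LinearMap.liftBaseChange_tmul, one_smul, hu,
          Polynomial.eval_smul]
        simp only [Polynomial.eval_add, Polynomial.eval_mul, Polynomial.eval_X, Polynomial.eval_C,
          hone _ (hdeg q), F, hone f le_rfl, mul_one]
        exact congrArg (t • ·) (Polynomial.modByMonic_add_div (αQ q) f)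
      | add z z' h h' => simp [h, h']
    simp [v, hz, F, hone f le_rfl, mul_comm]
  have hspan : Ideal.span (Set.range v) = ⊤ := by
    by_contra hne
    obtain ⟨m, hm, hle⟩ := Ideal.exists_le_maximal _ hne
    let _ := Ideal.Quotient.field m
    let ψ : Polynomial S →ₐ[R] Polynomial S ⧸ m := Ideal.Quotient.mkₐ R m
    have hψ (y) : ψ (v y) = 0 :=
      Ideal.Quotient.eq_zero_iff_mem.2 (hle (Ideal.subset_span ⟨y, rfl⟩))
    have hψF : ψ F = 0 := by rw [← hvF, hψ]
    by_cases hw : ψ Polynomial.X = 0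
    · have : ψ F = 1 := by
        simp only [F, map_homogEval, hw, homogEval_zero_right, n, hf.coeff_natDegree]
        simp [x, hw]
      exact one_ne_zero (this.symm.trans hψF)
    · let r := ψ x / ψ Polynomial.X
      have hr (g : Polynomial R) (hg : g.natDegree ≤ n)
          (h : ψ (homogEval n x Polynomial.X g) = 0) : Polynomial.aeval r g = 0 := by
        rw [map_homogEval, ← mul_div_cancel₀ (ψ x) hw, homogEval_mul_self _ _ hg] at h
        exact (mul_eq_zero.1 h).resolve_left (pow_ne_zero _ hw)
      have hrf : Polynomial.aeval r f = 0 := hr f le_rfl hψF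
      have hrα (z : S ⊗[R] Q) : Polynomial.aeval r (α z) = 0 := by
        induction z with
        | zero => simp
        | tmul t q =>
          have ht : t ⊗ₜ[R] q = t • ((1 : S) ⊗ₜ[R] q) := by simp [TensorProduct.smul_tmul']
          have hq := hψ (1 ⊗ₜ q, 0)
          rw [hv1, hu, map_add, map_mul, map_mul, hψF, zero_mul, zero_mul, add_zero] at hq
          rw [ht, map_smul, smul_eq_mul, map_mul, ← hα, ← Polynomial.modByMonic_add_div (αQ q) f,
            map_add, map_mul, hrf, hr _ (hdeg q) hq]
          simp
        | add z z' h h' => rw [map_add, map_add, h, h', add_zero]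
      obtain ⟨y, hy⟩ := hsurj 1
      have := congrArg (Polynomial.aeval r) hy
      simp [hrα, hrf] at this
  obtain ⟨σ, hσ, h⟩ := exists_isotopicToId_of_monic v (by
    rw [hvF]
    nontriviality S
    exact monic_homogEval hx (by
      simp only [x]
      compute_degree!) hf) hspan hv0
  exact ⟨σ, hσ, fun y ↦ (h y).trans (hv1' y)⟩
end

section
/- Let A be an affine algebra over 𝔽̄_p of dimension d and P a finitely generated projective A[T]-module of rank n which is extended from A (i.e., P ≅ Q ⊗_A A[T] for some projective A-module Q), with 2n ≥ d + 2. If P_f has a unimodular element for some monic polynomial f ∈ A[T], then P has a unimodular element. -/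
open TensorProduct

/-- `Spec A` is regular at the prime `p` if the maximal ideal of the (Noetherian) local ring
`A_p` is generated by `dim A_p` elements. -/
def RegularAt (A : Type*) [CommRing A] (p : PrimeSpectrum A) : Prop :=
  ∃ s : Finset (Localization.AtPrime p.asIdeal),
    Ideal.span (s : Set (Localization.AtPrime p.asIdeal)) = IsLocalRing.maximalIdeal _ ∧
    (s.card : WithBot (WithTop ℕ)) = ringKrullDim (Localization.AtPrime p.asIdeal)

universe u v

namespace ExtendedProjective

open scoped nonZeroDivisors

theorem exists_add_algebraMap_mem_nonZeroDivisors (k : Type v) [Field k] [Infinite k] {P : Type u}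
    [CommRing P] [Algebra k P] [IsNoetherianRing P] (h : P) :
    ∃ a : k, h + algebraMap k P a ∈ P⁰ := by
  by_contra! H
  have hfin := associatedPrimes.finite P P
  have hH : ∀ a : k, ∃ q ∈ associatedPrimes P P, h + algebraMap k P a ∈ q := fun a => by
    have : h + algebraMap k P a ∈ (P⁰ : Set P)ᶜ := H a
    rw [← biUnion_associatedPrimes_eq_compl_nonZeroDivisors] at this
    simpa using this
  choose q hq hq' using hH
  have := hfin.to_subtype
  obtain ⟨a, b, hab, he⟩ := Finite.exists_ne_map_eq_of_infinite
    fun a : k => (⟨q a, hq a⟩ : associatedPrimes P P)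
  rw [Subtype.mk.injEq] at he
  have h1 : algebraMap k P (a - b) ∈ q a := by
    have := (q a).sub_mem (hq' a) (he ▸ hq' b)
    simpa using this
  have hu : IsUnit (algebraMap k P (a - b)) := (sub_ne_zero.2 hab).isUnit.map _
  exact (hq a).isPrime.ne_top ((q a).eq_top_of_isUnit_mem h1 hu)

theorem exists_forall_surjective_ringKrullDim_add_le (k : Type v) [Field k] [Infinite k] (m : ℕ) :
    ∀ {P : Type u} [CommRing P] [Algebra k P] [IsNoetherianRing P] (h : Fin m → P),
    ∃ a : Fin m → k, ∀ {K : Type u} [CommRing K] (ρ : P →+* K), Function.Surjective ρ →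
      (∀ i, ρ (h i + algebraMap k P (a i)) = 0) → ringKrullDim K + m ≤ ringKrullDim P := by
  induction m with
  | zero =>
    intro P _ _ _ h
    refine ⟨Fin.elim0, fun ρ hρ _ => ?_⟩
    simpa using ringKrullDim_le_of_surjective ρ hρ
  | succ m ih =>
    intro P _ _ _ h
    obtain ⟨a₀, ha₀⟩ := exists_add_algebraMap_mem_nonZeroDivisors k (h 0)
    obtain ⟨a, ha⟩ := ih fun i =>
      Ideal.Quotient.mk (Ideal.span {h 0 + algebraMap k P a₀}) (h i.succ)
    refine ⟨Fin.cons a₀ a, fun {K} _ ρ hρ hz => ?_⟩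
    have h0 : ρ (h 0 + algebraMap k P a₀) = 0 := by simpa using hz 0
    have hle : Ideal.span {h 0 + algebraMap k P a₀} ≤ RingHom.ker ρ :=
      (Ideal.span_singleton_le_iff_mem _).2 h0
    have := ha (Ideal.Quotient.lift _ ρ hle)
      (Ideal.Quotient.lift_surjective_of_surjective _ _ hρ) fun i => by
        have h1 := hz i.succ
        rw [Fin.cons_succ] at h1
        rw [← Ideal.Quotient.mk_algebraMap, ← map_add]
        exact h1
    grw [← ringKrullDim_quotient_succ_le_of_nonZeroDivisor ha₀, ← this]
    simp [add_assoc]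

open Matrix Polynomial TensorProduct

theorem exists_span_add_vecMul_eq_top (k : Type v) [Field k] [Infinite k] {R : Type u}
    [CommRing R] [Algebra k R] [IsNoetherianRing R] {ι ν : Type} [Fintype ι]
    [Fintype ν] [DecidableEq ν] (E : Matrix ι ι R) (g : ι → R)
    (hE : ∀ q : Ideal R, q.IsMaximal → ∃ (B : Matrix ι ν (R ⧸ q)) (B' : Matrix ν ι (R ⧸ q)),
      B' * B = 1 ∧ B * B' = E.map (Ideal.Quotient.mk q))
    (hdim : ringKrullDim R < Fintype.card ν) :
    ∃ a : ι → k, Ideal.span (Set.range (g + (fun i => algebraMap k R (a i)) ᵥ* E)) = ⊤ := by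
  classical
  let H : ι → MvPolynomial ι R := fun i =>
    MvPolynomial.C (g i) + (MvPolynomial.X i - ∑ j, MvPolynomial.X j * MvPolynomial.C (E j i))
  let ε := Fintype.equivFin ι
  obtain ⟨a, ha⟩ := exists_forall_surjective_ringKrullDim_add_le k (Fintype.card ι) (H ∘ ε.symm)
  refine ⟨a ∘ ε, ?_⟩
  by_contra htop
  obtain ⟨q, hq, hle⟩ := Ideal.exists_le_maximal _ htop
  obtain ⟨B, B', h1, h2⟩ := hE q hq
  let _ : Field (R ⧸ q) := Ideal.Quotient.field q
  let γ : R →+* MvPolynomial ν (R ⧸ q) := MvPolynomial.C.comp (Ideal.Quotient.mk q)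
  let α : ι → MvPolynomial ν (R ⧸ q) := fun i => γ (algebraMap k R (a (ε i)))
  let D : Matrix ι ν (MvPolynomial ν (R ⧸ q)) := B.map MvPolynomial.C
  let D' : Matrix ν ι (MvPolynomial ν (R ⧸ q)) := B'.map MvPolynomial.C
  have hD : D' * D = 1 := by
    simp only [D, D']
    rw [← Matrix.map_mul, h1, Matrix.map_one _ (map_zero _) (map_one _)]
  have hD' : D * D' = E.map γ := by
    simp only [D, D']
    rw [← Matrix.map_mul, h2]
    rfl
  let x : ι → MvPolynomial ν (R ⧸ q) := MvPolynomial.X ᵥ* D' - α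
  let ρ : MvPolynomial ι R →+* MvPolynomial ν (R ⧸ q) := MvPolynomial.eval₂Hom γ x
  have hρ : Function.Surjective ρ := by
    intro y
    change y ∈ ρ.range
    induction y using MvPolynomial.induction_on with
    | C c =>
      obtain ⟨c, rfl⟩ := Ideal.Quotient.mk_surjective c
      exact ⟨MvPolynomial.C c, by simp [ρ, γ]⟩
    | add y z hy hz => exact add_mem hy hz
    | mul_X y j hy =>
      refine mul_mem hy ?_
      choose b hb using fun i => Ideal.Quotient.mk_surjective (B i j)
      refine ⟨∑ i, (MvPolynomial.X i + MvPolynomial.C (algebraMap k R (a (ε i)))) *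
        MvPolynomial.C (b i), ?_⟩
      have : (MvPolynomial.X ᵥ* D' ᵥ* D) j = (MvPolynomial.X j : MvPolynomial ν (R ⧸ q)) := by
        rw [vecMul_vecMul, hD, vecMul_one]
      rw [← this, vecMul, dotProduct]
      simp [ρ, x, γ, α, hb, D]
  have hx : γ ∘ g + x - x ᵥ* (E.map γ) + α = 0 := by
    have h3 : γ ∘ g + α ᵥ* (E.map γ) = 0 := by
      funext i
      have : γ ((g + (fun i => algebraMap k R ((a ∘ ε) i)) ᵥ* E) i) = 0 := by
        have := Ideal.Quotient.eq_zero_iff_mem.2 (hle (Ideal.subset_span (Set.mem_range_self i)))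
        change MvPolynomial.C _ = _
        rw [this, map_zero]
      simpa [vecMul, dotProduct, α] using this
    have h4 : (MvPolynomial.X ᵥ* D') ᵥ* (E.map γ) = MvPolynomial.X ᵥ* D' := by
      rw [← hD', vecMul_vecMul, ← Matrix.mul_assoc, hD, Matrix.one_mul]
    simp only [x, sub_vecMul, h4]
    linear_combination h3
  have hdim' := ha ρ hρ fun i => by
    have := congrFun hx (ε.symm i)
    simpa [H, ρ, vecMul, dotProduct, α, MvPolynomial.algebraMap_apply, add_sub_assoc] using this
  rw [MvPolynomial.ringKrullDim_of_isNoetherianRing, MvPolynomial.ringKrullDim_of_isNoetherianRing,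
    ringKrullDim_eq_zero_of_field] at hdim'
  simp only [Nat.card_eq_fintype_card, zero_add] at hdim'
  refine hdim'.not_gt ?_
  generalize ringKrullDim R = δ at hdim
  induction δ with
  | bot =>
    rw [WithBot.bot_add]
    exact WithBot.bot_lt_coe (_ : ℕ∞)
  | coe δ =>
    induction δ with
    | top => exact absurd hdim (by simp)
    | coe δ =>
      norm_cast at hdim ⊢
      lia

theorem algHom_apply_eq_of_span_eq_top {A B ι T : Type*} [CommRing A] [CommRing B] [Algebra A B]
    [CommRing T] [Algebra A T] (t : B) (φ : ι → A[X]) (hφ : ∀ j, aeval t (φ j) = 0)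
    (z : A) (hz : algebraMap A B z = 0) (Δ : ι → A[X][X])
    (hΔ : ∀ j, (X - C X) * Δ j = (φ j).map C - C (φ j))
    (htop : Ideal.span (Set.range Δ) ⊔ Ideal.span (Set.range fun j => C (φ j)) ⊔
      Ideal.span {C (C z)} = ⊤) (l r : B →ₐ[A] T) : r t = l t := by
  let Θ : A[X][X] →+* T := eval₂RingHom (aeval (l t)).toRingHom (r t)
  have hΘC : ∀ q : A[X], Θ (C q) = l (aeval t q) := fun q => by
    simp [Θ, aeval_algHom_apply]
  have hΘz : Θ (C (C z)) = 0 := by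
    rw [hΘC, aeval_C, hz, map_zero]
  have hΘm : ∀ q : A[X], Θ (q.map C) = r (aeval t q) := fun q => by
    rw [← aeval_algHom_apply, aeval_def]
    simp only [Θ, coe_eval₂RingHom, eval₂_map]
    congr 1
    ext a
    simp
  have hΘX : Θ X = r t := by simp [Θ]
  rw [← sub_eq_zero]
  have key : ⊤ ≤ Ideal.comap Θ (LinearMap.ker (LinearMap.toSpanSingleton T T (r t - l t))) := by
    rw [← htop, sup_le_iff, sup_le_iff]
    refine ⟨⟨Ideal.span_le.2 ?_, Ideal.span_le.2 ?_⟩, Ideal.span_le.2 ?_⟩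
    · rintro _ ⟨j, rfl⟩
      have := congrArg Θ (hΔ j)
      rw [map_mul, map_sub, map_sub, hΘX, hΘC, hΘC, hΘm,
        hφ j, map_zero, map_zero, sub_zero, mul_comm, aeval_X] at this
      exact this
    · rintro _ ⟨j, rfl⟩
      change Θ (C (φ j)) * (r t - l t) = 0
      rw [hΘC, hφ j, map_zero, zero_mul]
    · rintro _ rfl
      change Θ (C (C z)) * (r t - l t) = 0
      rw [hΘz, zero_mul]
  have h1 : Θ 1 * (r t - l t) = 0 := key (Submodule.mem_top (x := (1 : A[X][X])))
  simpa using h1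

theorem isEpi_of_span_eq_top {A B ι : Type*} [CommRing A] [CommRing B] [Algebra A B] (t : B)
    (ht : Function.Surjective (aeval (R := A) t)) (φ : ι → A[X]) (hφ : ∀ j, aeval t (φ j) = 0)
    (z : A) (hz : algebraMap A B z = 0) (Δ : ι → A[X][X])
    (hΔ : ∀ j, (X - C X) * Δ j = (φ j).map C - C (φ j))
    (htop : Ideal.span (Set.range Δ) ⊔ Ideal.span (Set.range fun j => C (φ j)) ⊔
      Ideal.span {C (C z)} = ⊤) : Algebra.IsEpi A B := by
  refine (Algebra.isEpi_iff_forall_one_tmul_eq A B).2 fun b => ?_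
  obtain ⟨q, rfl⟩ := ht b
  let l : B →ₐ[A] B ⊗[A] B := Algebra.TensorProduct.includeLeft
  let r : B →ₐ[A] B ⊗[A] B := Algebra.TensorProduct.includeRight
  change r (aeval t q) = l (aeval t q)
  rw [← aeval_algHom_apply, ← aeval_algHom_apply,
    algHom_apply_eq_of_span_eq_top t φ hφ z hz Δ hΔ htop l r]

theorem exists_C_mul_X_sub_C_mem {A ι : Type*} [CommRing A] (φ : ι → A[X]) (g : A[X])
    (hg : g.Monic) (hgφ : g ∈ Ideal.span (Set.range φ)) (z : A) (Δ : ι → A[X][X])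
    (hΔ : ∀ j, (X - C X) * Δ j = (φ j).map C - C (φ j))
    (htop : Ideal.span (Set.range Δ) ⊔ Ideal.span (Set.range fun j => C (φ j)) ⊔
      Ideal.span {C (C z)} = ⊤) :
    ∃ s y : A, s - 1 ∈ Ideal.span {z} ∧ C s * X - C y ∈ Ideal.span (Set.range φ) := by
  set I := Ideal.span (Set.range φ) with hI
  let J := I ⊔ Ideal.span {C z}
  have hfin : ∀ K : Ideal A[X], I ≤ K → Module.Finite A (A[X] ⧸ K) := fun K hK => by
    have := hg.finite_quotient
    have hle : Ideal.span {g} ≤ K := (Ideal.span_singleton_le_iff_mem _).2 (hK hgφ)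
    exact Module.Finite.of_surjective (Ideal.Quotient.factorₐ A hle).toLinearMap
      (Ideal.Quotient.factor_surjective hle)
  have := hfin I le_rfl
  have := hfin J le_sup_left
  have ht : ∀ q : A[X], aeval (Ideal.Quotient.mk J X) q = Ideal.Quotient.mk J q := fun q => by
    change aeval (Ideal.Quotient.mkₐ A J X) q = Ideal.Quotient.mkₐ A J q
    rw [aeval_algHom_apply, aeval_X_left_apply]
  have hepi : Algebra.IsEpi A (A[X] ⧸ J) :=
    isEpi_of_span_eq_top (Ideal.Quotient.mk J X)
      (fun b => (Ideal.Quotient.mk_surjective b).imp fun q hq => (ht q).trans hq) φ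
      (fun j => (ht _).trans (Ideal.Quotient.eq_zero_iff_mem.2
        (le_sup_left (a := I) (Ideal.subset_span (Set.mem_range_self j))))) z
      (Ideal.Quotient.eq_zero_iff_mem.2 (le_sup_right (a := I) (Ideal.mem_span_singleton_self _)))
      Δ hΔ htop
  have hsurj := Algebra.isEpi_iff_surjective_algebraMap_of_finite.1 hepi
  let N := LinearMap.range (Algebra.linearMap A (A[X] ⧸ I))
  obtain ⟨s, hs, hsN⟩ := Submodule.exists_sub_one_mem_and_smul_eq_zero_of_fg_of_le_smul
    (Ideal.span {z}) (⊤ : Submodule A ((A[X] ⧸ I) ⧸ N)) Module.Finite.fg_top (by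
      rintro b -
      obtain ⟨b, rfl⟩ := N.mkQ_surjective b
      obtain ⟨q, rfl⟩ := Ideal.Quotient.mk_surjective b
      obtain ⟨a, ha⟩ := hsurj (Ideal.Quotient.mk J q)
      have ha : q - C a ∈ J := by
        rw [← Ideal.Quotient.eq_zero_iff_mem, map_sub, ← ha]
        exact sub_self _
      obtain ⟨i, hi, w, hw, hiw⟩ := Submodule.mem_sup.1 ha
      obtain ⟨w, rfl⟩ := Ideal.mem_span_singleton'.1 hw
      have : N.mkQ (Ideal.Quotient.mk I q) = z • N.mkQ (Ideal.Quotient.mk I w) := by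
        rw [← map_smul, ← sub_eq_zero, ← map_sub]
        refine (Submodule.Quotient.mk_eq_zero _).2 ⟨a, ?_⟩
        have h1 : Ideal.Quotient.mk I i = 0 := Ideal.Quotient.eq_zero_iff_mem.2 hi
        have h2 := congrArg (Ideal.Quotient.mk I) hiw
        rw [map_add, h1, zero_add, map_sub, map_mul] at h2
        change Ideal.Quotient.mk I (C a) = Ideal.Quotient.mk I q - Ideal.Quotient.mk I (z • w)
        rw [smul_eq_C_mul, mul_comm, map_mul, h2, sub_sub_cancel]
      rw [this]
      exact Submodule.smul_mem_smul (Ideal.mem_span_singleton_self z) Submodule.mem_top)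
  obtain ⟨y, hy⟩ := (Submodule.Quotient.mk_eq_zero N).1
    (hsN (N.mkQ (Ideal.Quotient.mk I X)) Submodule.mem_top)
  refine ⟨s, y, hs, ?_⟩
  rw [← Ideal.Quotient.eq_zero_iff_mem, map_sub, sub_eq_zero, ← smul_eq_C_mul]
  exact hy.symm

theorem span_homogenized_eq_top {A ι : Type*} [CommRing A] (φ : ι → A[X]) (N : ℕ)
    (hN : ∀ j, (φ j).natDegree ≤ N) (z s y : A)
    (hz : z ∈ Ideal.span (Set.range fun j => (φ j).coeff N)) (hs : s - 1 ∈ Ideal.span {z})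
    (hy : C s * X - C y ∈ Ideal.span (Set.range φ)) :
    Ideal.span (Set.range fun j => ∑ i ∈ Finset.range (N + 1),
      (φ j).coeff i * ((1 + y * s) ^ i * (s ^ 2) ^ (N - i))) = ⊤ := by
  by_contra htop
  obtain ⟨q, hq, hle⟩ := Ideal.exists_le_maximal _ htop
  let _ : Field (A ⧸ q) := Ideal.Quotient.field q
  let π := Ideal.Quotient.mk q
  have hχ : ∀ j, ∑ i ∈ Finset.range (N + 1),
      π ((φ j).coeff i) * ((1 + π y * π s) ^ i * (π s ^ 2) ^ (N - i)) = 0 := fun j => by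
    have := Ideal.Quotient.eq_zero_iff_mem.2 (hle (Ideal.subset_span (Set.mem_range_self j)))
    simpa using this
  by_cases hsq : π s = 0
  · have hcoeff : ∀ j, π ((φ j).coeff N) = 0 := fun j => by
      have := hχ j
      rw [Finset.sum_range_succ, Finset.sum_eq_zero] at this
      · simpa [hsq] using this
      · intro i hi
        have : N - i ≠ 0 := by have := Finset.mem_range.1 hi; lia
        simp [hsq, this]
    have hzq : z ∈ q := by
      refine (Ideal.span_le.2 ?_ : Ideal.span (Set.range fun j => (φ j).coeff N) ≤ q) hz
      rintro _ ⟨j, rfl⟩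
      exact Ideal.Quotient.eq_zero_iff_mem.1 (hcoeff j)
    have h1 : s - 1 ∈ q := (Ideal.span_singleton_le_iff_mem q).2 hzq hs
    have h2 : (1 : A) ∈ q := by
      have := q.sub_mem (Ideal.Quotient.eq_zero_iff_mem.1 hsq) h1
      simpa using this
    exact hq.ne_top (q.eq_top_iff_one.2 h2)
  · let t : A ⧸ q := (1 + π y * π s) / π s ^ 2
    have ht : ∀ j, eval₂ π t (φ j) = 0 := fun j => by
      have h0 : (π s ^ 2) ^ N * eval₂ π t (φ j) = 0 := by
        rw [eval₂_eq_sum_range' π (Nat.lt_succ_of_le (hN j)), Finset.mul_sum, ← hχ j]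
        refine Finset.sum_congr rfl fun i hi => ?_
        have hi : i ≤ N := by have := Finset.mem_range.1 hi; lia
        obtain ⟨l, rfl⟩ := Nat.exists_eq_add_of_le hi
        simp only [t, div_pow, Nat.add_sub_cancel_left, pow_add]
        field_simp
      exact (mul_eq_zero.1 h0).resolve_left (pow_ne_zero _ (pow_ne_zero _ hsq))
    have hle' : Ideal.span (Set.range φ) ≤ RingHom.ker (eval₂RingHom π t) := by
      rw [Ideal.span_le]
      rintro _ ⟨j, rfl⟩
      exact ht j
    have h1 : π s * t - π y = 0 := by simpa using RingHom.mem_ker.1 (hle' hy)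
    have h2 : (1 : A ⧸ q) = 0 := by
      simp only [t] at h1
      field_simp at h1
      linear_combination h1
    exact one_ne_zero h2

/-- An idempotent matrix `e`, seen as a projection, has rank `n` over every residue field. -/
def HasFibreRank {A : Type u} [CommRing A] {ι : Type} [Fintype ι] (e : Matrix ι ι A) (n : ℕ) :
    Prop :=
  ∀ (κ : Type u) [Field κ] (θ : A →+* κ), ∃ (B : Matrix ι (Fin n) κ) (B' : Matrix (Fin n) ι κ),
    B' * B = 1 ∧ B * B' = e.map θ

theorem exists_span_add_vecMul_sup_eq_top (k : Type v) [Field k] [Infinite k] {R : Type u}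
    [CommRing R] [Algebra k R] [IsNoetherianRing R] {ι ν : Type} [Fintype ι]
    [Fintype ν] [DecidableEq ν] (E : Matrix ι ι R) (g₀ g₁ : ι → R)
    (hE : ∀ q : Ideal R, q.IsMaximal → ∃ (B : Matrix ι ν (R ⧸ q)) (B' : Matrix ν ι (R ⧸ q)),
      B' * B = 1 ∧ B * B' = E.map (Ideal.Quotient.mk q))
    (hdim : ringKrullDim R < Fintype.card (ν ⊕ ν)) :
    ∃ a₀ a₁ : ι → k, Ideal.span (Set.range (g₀ + (fun i => algebraMap k R (a₀ i)) ᵥ* E)) ⊔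
      Ideal.span (Set.range (g₁ + (fun i => algebraMap k R (a₁ i)) ᵥ* E)) = ⊤ := by
  obtain ⟨a, ha⟩ := exists_span_add_vecMul_eq_top k (ν := ν ⊕ ν) (fromBlocks E 0 0 E)
    (Sum.elim g₀ g₁) (fun q hq => by
      obtain ⟨B, B', h1, h2⟩ := hE q hq
      refine ⟨fromBlocks B 0 0 B, fromBlocks B' 0 0 B', ?_, ?_⟩
      · rw [fromBlocks_multiply]
        simp [h1]
      · rw [fromBlocks_multiply, fromBlocks_map, h2]
        simp) hdim
  refine ⟨a ∘ Sum.inl, a ∘ Sum.inr, ?_⟩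
  rw [← Ideal.span_union, ← ha]
  congr 1
  rw [vecMul_fromBlocks, ← Set.Sum.elim_range]
  congr 1
  ext (i | i) <;> simp [Function.comp_def]

theorem exists_span_dividedDifference_eq_top (k : Type v) [Field k] [Infinite k] {A : Type u}
    [CommRing A] [Algebra k A] [IsNoetherianRing A] {ι : Type} [Fintype ι] {n : ℕ}
    (hn : ringKrullDim A + 2 ≤ (2 * n : ℕ)) (e : Matrix ι ι A)
    (he : e * e = e) (hrk : HasFibreRank e n) {z : A} (hz : z ∈ A⁰) (F : ι → A[X]) :
    ∃ (θ₀ θ₁ : ι → A) (Δ : ι → A[X][X]), θ₀ ᵥ* e = θ₀ ∧ θ₁ ᵥ* e = θ₁ ∧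
      (∀ j, (X - C X) * Δ j =
        (F j + C (θ₀ j) + X * C (θ₁ j)).map C - C (F j + C (θ₀ j) + X * C (θ₁ j))) ∧
      Ideal.span (Set.range Δ) ⊔
        Ideal.span (Set.range fun j => C (F j + C (θ₀ j) + X * C (θ₁ j))) ⊔
        Ideal.span {C (C z)} = ⊤ := by
  have hdd : ∀ j, ∃ D : A[X][X], (X - C X) * D = (F j).map C - C (F j) := fun j => by
    obtain ⟨D, hD⟩ := X_sub_C_dvd_sub_C_eval (a := (X : A[X])) (p := (F j).map C)
    refine ⟨D, ?_⟩
    rw [← hD, eval_map, eval₂_C_X]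
  choose D hD using hdd
  let I : Ideal A[X][X] := Ideal.span {C (C z)}
  let π := Ideal.Quotient.mk I
  let γ : A →+* A[X][X] ⧸ I := π.comp (C.comp C)
  have hzz : (C (C z) : A[X][X]) ∈ A[X][X]⁰ :=
    mem_nonzeroDivisors_of_coeff_mem 0
      (by simpa using mem_nonzeroDivisors_of_coeff_mem (p := C z) 0 (by simpa using hz))
  have hdim : ringKrullDim (A[X][X] ⧸ I) < Fintype.card (Fin n ⊕ Fin n) := by
    have h1 := ringKrullDim_quotient_succ_le_of_nonZeroDivisor hzz
    rw [ringKrullDim_of_isNoetherianRing, ringKrullDim_of_isNoetherianRing, add_assoc,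
      one_add_one_eq_two] at h1
    have h2 := h1.trans hn
    rw [Fintype.card_sum, Fintype.card_fin, ← two_mul]
    generalize ringKrullDim (A[X][X] ⧸ Ideal.span {C (C z)}) = δ at h2
    have h3 : ((2 * n : ℕ) : WithBot ℕ∞) = ((2 * n : ℕ) : ℕ∞) := rfl
    rw [h3] at h2 ⊢
    induction δ with
    | bot => exact WithBot.bot_lt_coe _
    | coe δ =>
      rw [← WithBot.coe_one, ← WithBot.coe_add, WithBot.coe_le_coe] at h2
      rw [WithBot.coe_lt_coe]
      exact (ENat.add_one_le_iff (ne_top_of_le_ne_top (ENat.natCast_ne_top _)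
        (le_self_add.trans h2))).1 h2
  obtain ⟨a₀, a₁, ha⟩ := exists_span_add_vecMul_sup_eq_top k (e.map γ)
    (fun j => π (C (F j) - C X * D j)) (fun j => π (D j)) (fun q hq => by
      let _ : Field ((A[X][X] ⧸ I) ⧸ q) := Ideal.Quotient.field q
      exact hrk _ ((Ideal.Quotient.mk q).comp γ)) hdim
  let θ : (ι → k) → ι → A := fun b => (fun i => algebraMap k A (b i)) ᵥ* e
  have hθ : ∀ b, θ b ᵥ* e = θ b := fun b => by
    simp only [θ, vecMul_vecMul, he]
  have hθγ : ∀ b j, γ (θ b j) = ((fun i => algebraMap k (A[X][X] ⧸ I) (b i)) ᵥ* e.map γ) j :=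
    fun b j => by
      rw [RingHom.map_vecMul γ e (fun i => algebraMap k A (b i)) j]
      congr 2
      funext i
      rw [← Ideal.Quotient.mk_algebraMap, Polynomial.algebraMap_apply,
        Polynomial.algebraMap_apply]
      rfl
  let θ₀ := θ a₀
  let θ₁ := θ a₁
  refine ⟨θ₀, θ₁, fun j => D j + C (C (θ₁ j)), hθ _, hθ _, fun j => ?_, ?_⟩
  · rw [mul_add, hD]
    simp only [Polynomial.map_add, Polynomial.map_mul, map_C, map_X, map_add, map_mul]
    ring
  · set K := Ideal.span (Set.range fun j => D j + C (C (θ₁ j))) ⊔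
        Ideal.span (Set.range fun j => C (F j + C (θ₀ j) + X * C (θ₁ j))) ⊔
        Ideal.span {C (C z)} with hK
    have hIK : I ≤ K := le_sup_right
    rw [← Ideal.comap_map_mk hIK, Ideal.comap_eq_top_iff, eq_top_iff, ← ha, sup_le_iff, Ideal.span_le,
      Ideal.span_le]
    have hmem₁ : ∀ j, D j + C (C (θ₁ j)) ∈ K := fun j =>
      Ideal.mem_sup_left (Ideal.mem_sup_left (Ideal.subset_span (Set.mem_range_self j)))
    have hmem₂ : ∀ j, C (F j + C (θ₀ j) + X * C (θ₁ j)) ∈ K := fun j =>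
      Ideal.mem_sup_left (Ideal.mem_sup_right (Ideal.subset_span (Set.mem_range_self j)))
    refine ⟨?_, ?_⟩
    · rintro _ ⟨j, rfl⟩
      have h1 : π (C (F j + C (θ₀ j) + X * C (θ₁ j)) - C X * (D j + C (C (θ₁ j)))) ∈ K.map π :=
        Ideal.mem_map_of_mem _ (K.sub_mem (hmem₂ j) (K.mul_mem_left _ (hmem₁ j)))
      have h2 : C (F j + C (θ₀ j) + X * C (θ₁ j)) - C X * (D j + C (C (θ₁ j))) =
          C (F j) - C X * D j + C (C (θ₀ j)) := by
        simp only [map_add, map_mul]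
        ring
      rw [h2, map_add] at h1
      rw [Pi.add_apply, ← hθγ]
      exact h1
    · rintro _ ⟨j, rfl⟩
      have h1 : π (D j + C (C (θ₁ j))) ∈ K.map π := Ideal.mem_map_of_mem _ (hmem₁ j)
      rw [map_add] at h1
      rw [Pi.add_apply, ← hθγ]
      exact h1

theorem monic_sum_mul_perturbation {A ι : Type*} [CommRing A] [Nontrivial A] [Fintype ι]
    (p Φ : ι → A[X]) {f : A[X]} (hf : f.Monic) (hpΦ : ∑ j, p j * Φ j = f) (b : ℕ)
    (hb : ∀ j, (p j).natDegree + 1 < (b + 1) * f.natDegree) (θ₀ θ₁ : ι → A) :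
    (∑ j, p j * (f ^ b * Φ j + C (θ₀ j) + X * C (θ₁ j))).Monic := by
  have h : ∑ j, p j * (f ^ b * Φ j + C (θ₀ j) + X * C (θ₁ j)) =
      f ^ (b + 1) + ∑ j, p j * (C (θ₀ j) + X * C (θ₁ j)) := by
    have h1 : f ^ (b + 1) = f ^ b * ∑ j, p j * Φ j := by rw [hpΦ, pow_succ]
    rw [h1, Finset.mul_sum, ← Finset.sum_add_distrib]
    refine Finset.sum_congr rfl fun j _ => ?_
    ring
  rw [h]
  refine (hf.pow _).add_of_left ((degree_sum_le _ _).trans_lt ?_)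
  rw [Finset.sup_lt_iff (by simpa [bot_lt_iff_ne_bot] using (hf.pow (b + 1)).ne_zero)]
  intro j _
  rw [degree_eq_natDegree (hf.pow (b + 1)).ne_zero, hf.natDegree_pow]
  refine degree_le_natDegree.trans_lt (Nat.cast_lt.2 ?_)
  have h2 : (C (θ₀ j) + X * C (θ₁ j)).natDegree ≤ 1 := by
    compute_degree
  have := natDegree_mul_le (p := p j) (q := C (θ₀ j) + X * C (θ₁ j))
  have := hb j
  lia

theorem exists_vecMul_eq_span_eq_top_of_coeff (k : Type v) [Field k] [Infinite k] {A : Type u}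
    [CommRing A] [Algebra k A] [IsNoetherianRing A] {ι : Type} [Fintype ι] {n : ℕ}
    (hn : ringKrullDim A + 2 ≤ (2 * n : ℕ)) (e : Matrix ι ι A)
    (he : e * e = e) (hrk : HasFibreRank e n) {z : A} (hz : z ∈ A⁰) (Φ : ι → A[X])
    (hΦ : Φ ᵥ* e.map C = Φ) {f : A[X]} (hf : f.Monic) (hfΦ : f ∈ Ideal.span (Set.range Φ))
    {M : ℕ} (hM : 2 ≤ M) (hΦM : ∀ j, (Φ j).natDegree ≤ M)
    (hzΦ : z ∈ Ideal.span (Set.range fun j => (Φ j).coeff M)) :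
    ∃ c : ι → A, c ᵥ* e = c ∧ Ideal.span (Set.range c) = ⊤ := by
  rcases subsingleton_or_nontrivial A with _ | _
  · exact ⟨0, Subsingleton.elim _ _, Subsingleton.elim _ _⟩
  have hf' : (X * f).Monic := monic_X.mul hf
  obtain ⟨p, hp⟩ := (Ideal.mem_span_range_iff_exists_fun ..).1 (Ideal.mul_mem_left _ X hfΦ)
  let b := Finset.univ.sup fun j => (p j).natDegree + 1
  have hdeg : 1 ≤ (X * f).natDegree := by
    rw [monic_X.natDegree_mul hf, natDegree_X]
    lia
  have hb : ∀ j, (p j).natDegree + 1 < (b + 1) * (X * f).natDegree := fun j => by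
    have : (p j).natDegree + 1 ≤ b :=
      Finset.le_sup (f := fun j => (p j).natDegree + 1) (Finset.mem_univ j)
    nlinarith
  obtain ⟨θ₀, θ₁, Δ, hθ₀, hθ₁, hΔ, htop⟩ := exists_span_dividedDifference_eq_top k hn e he hrk hz
    fun j => (X * f) ^ b * Φ j
  set φ : ι → A[X] := fun j => (X * f) ^ b * Φ j + C (θ₀ j) + X * C (θ₁ j) with hφ
  have hmem : ∑ j, p j * φ j ∈ Ideal.span (Set.range φ) :=
    Ideal.sum_mem _ fun j _ =>
      Ideal.mul_mem_left _ _ (Ideal.subset_span (Set.mem_range_self j))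
  obtain ⟨s, y, hs, hy⟩ := exists_C_mul_X_sub_C_mem φ _
    (monic_sum_mul_perturbation p Φ hf' hp b hb θ₀ θ₁) hmem z Δ hΔ htop
  have hfb : ((X * f) ^ b).natDegree = b * (X * f).natDegree := hf'.natDegree_pow b
  let N := b * (X * f).natDegree + M
  have hN : ∀ j, (φ j).natDegree ≤ N := fun j => by
    have h1 : ((X * f) ^ b * Φ j).natDegree ≤ N :=
      natDegree_mul_le.trans (Nat.add_le_add hfb.le (hΦM j))
    have h2 : (X * C (θ₁ j)).natDegree ≤ N :=
      (natDegree_mul_C_le _ _).trans (natDegree_X_le.trans (by lia))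
    exact natDegree_add_le_of_degree_le
      (natDegree_add_le_of_degree_le h1 ((natDegree_C _).le.trans (Nat.zero_le _))) h2
  have hcoeff : ∀ j, (φ j).coeff N = (Φ j).coeff M := fun j => by
    have h1 : ((X * f) ^ b).coeff (b * (X * f).natDegree) = 1 := by
      rw [← hfb]
      exact (hf'.pow b).coeff_natDegree
    have h2 : (X * C (θ₁ j)).coeff N = 0 := by
      rw [coeff_mul_C, coeff_X, if_neg (by lia), zero_mul]
    rw [hφ, coeff_add, coeff_add, h2, coeff_C, if_neg (by lia),
      coeff_mul_add_eq_of_natDegree_le hfb.le (hΦM j), h1]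
    ring
  have hφe : φ ᵥ* e.map C = φ := by
    have h1 : ∀ θ : ι → A, θ ᵥ* e = θ → (fun j => C (θ j)) ᵥ* e.map C = fun j => C (θ j) :=
      fun θ hθ => by
        funext j
        conv_rhs => rw [← hθ]
        exact (RingHom.map_vecMul C e θ j).symm
    have h2 : φ = (X * f) ^ b • Φ + (fun j => C (θ₀ j)) +
        (X : A[X]) • (fun j => C (θ₁ j)) := by
      funext j
      simp [hφ]
    rw [h2, add_vecMul, add_vecMul, smul_vecMul, smul_vecMul, h1 θ₀ hθ₀, h1 θ₁ hθ₁, hΦ]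
  refine ⟨_, ?_, span_homogenized_eq_top φ N hN z s y (by simpa only [hcoeff] using hzΦ) hs hy⟩
  funext j
  have h1 : ∀ i, ∑ l, (φ l).coeff i * e l j = (φ j).coeff i := fun i => by
    conv_rhs => rw [← hφe, vecMul, dotProduct, finsetSum_coeff]
    exact Finset.sum_congr rfl fun l _ => (coeff_mul_C _ _ _).symm
  simp only [vecMul, dotProduct, Finset.sum_mul]
  rw [Finset.sum_comm]
  refine Finset.sum_congr rfl fun i _ => ?_
  rw [← h1, Finset.sum_mul]
  exact Finset.sum_congr rfl fun l _ => by ring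

theorem exists_vecMul_eq_sum_mul_eq_zero {A : Type u} [CommRing A] {ι : Type} [Fintype ι] {n : ℕ}
    (hn : 2 ≤ n) (e : Matrix ι ι A) (he : e * e = e) (hrk : HasFibreRank e n) (p Φ : ι → A[X])
    (hΦ : Φ ᵥ* e.map C = Φ) (hmonic : (∑ j, p j * Φ j).Monic) (q : Ideal A) [q.IsPrime] :
    ∃ Ψ : ι → A[X], Ψ ᵥ* e.map C = Ψ ∧ ∑ j, p j * Ψ j = 0 ∧ ∃ j i, (Ψ j).coeff i ∉ q := by
  let w := e.map C *ᵥ p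
  have heC : e.map C * e.map C = e.map C := by
    rw [← Matrix.map_mul, he]
  let Ψ : ι → ι → ι → A[X] := fun i l => w i • (e.map C) l - w l • (e.map C) i
  have hrow : ∀ l, (e.map C) l ᵥ* e.map C = (e.map C) l := fun l => by
    conv_rhs => rw [← heC]
    rfl
  by_contra! H
  let κ := FractionRing (A ⧸ q)
  let θ : A →+* κ := (algebraMap (A ⧸ q) κ).comp (Ideal.Quotient.mk q)
  have hθ : ∀ a ∈ q, θ a = 0 := fun a ha => by
    simp [θ, Ideal.Quotient.eq_zero_iff_mem.2 ha]
  have hzero : ∀ i l j, (w i).map θ * C (θ (e l j)) = (w l).map θ * C (θ (e i j)) := by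
    intro i l j
    have h1 := H (Ψ i l) (by
      simp only [Ψ, sub_vecMul, smul_vecMul, hrow]) (by
      have h2 : ∀ l, ∑ j, p j * (e.map C) l j = w l := fun l => by
        simp [w, mulVec, dotProduct, mul_comm]
      simp only [Ψ, Pi.sub_apply, Pi.smul_apply, smul_eq_mul, mul_sub, Finset.sum_sub_distrib,
        mul_left_comm (p _), ← Finset.mul_sum, h2]
      ring) j
    have h3 : (Ψ i l j).map θ = 0 := by
      ext m
      rw [coeff_map, coeff_zero, hθ _ (h1 m)]
    rw [← sub_eq_zero, ← h3]
    simp [Ψ]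
  obtain ⟨i, hi⟩ : ∃ i, (w i).map θ ≠ 0 := by
    by_contra! hw
    have h1 : ∑ j, p j * Φ j = Φ ⬝ᵥ w := by
      rw [dotProduct_mulVec, hΦ]
      simp [dotProduct, mul_comm]
    have h2 := (hmonic.map θ).ne_zero
    rw [h1] at h2
    refine h2 ?_
    simp [dotProduct, Polynomial.map_sum, hw]
  obtain ⟨B, B', h1, h2⟩ := hrk κ θ
  let u : Fin n → κ[X] := B'.map C *ᵥ fun l => (w l).map θ
  let v : Fin n → κ[X] := fun b => ∑ j, C (θ (e i j)) * C (B j b)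
  have huv : ∀ a b, (w i).map θ * C ((1 : Matrix (Fin n) (Fin n) κ) a b) = u a * v b := by
    intro a b
    have h3 : (1 : Matrix (Fin n) (Fin n) κ) = B' * (e.map θ * B) := by
      rw [← h2, Matrix.mul_assoc, h1, Matrix.mul_one, h1]
    rw [h3]
    simp only [Matrix.mul_apply, u, v, mulVec, dotProduct, map_sum, Finset.mul_sum,
      Finset.sum_mul, map_apply, map_mul]
    rw [Finset.sum_comm]
    refine Finset.sum_congr rfl fun j _ => Finset.sum_congr rfl fun l _ => ?_
    linear_combination C (B' a l) * C (B j b) * hzero i l j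
  have h00 := huv ⟨0, by lia⟩ ⟨0, by lia⟩
  have h11 := huv ⟨1, by lia⟩ ⟨1, by lia⟩
  have h01 := huv ⟨0, by lia⟩ ⟨1, by lia⟩
  rw [Matrix.one_apply_eq, C_1, mul_one] at h00 h11
  rw [Matrix.one_apply_ne (by simp), C_0, mul_zero] at h01
  refine pow_ne_zero 2 hi ?_
  linear_combination (w i).map θ * h00 + u ⟨0, by lia⟩ * v ⟨0, by lia⟩ * h11 -
    v ⟨0, by lia⟩ * u ⟨1, by lia⟩ * h01

theorem eq_zero_of_mem_minimalPrimes {A : Type*} [CommRing A] [IsReduced A] {x : A}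
    (hx : ∀ q ∈ minimalPrimes A, x ∈ q) : x = 0 := by
  have h1 : x ∈ sInf (⊥ : Ideal A).minimalPrimes := Submodule.mem_sInf.2 hx
  rw [Ideal.sInf_minimalPrimes] at h1
  obtain ⟨m, hm⟩ := h1
  exact eq_zero_of_pow_eq_zero hm

theorem exists_mem_nonZeroDivisors_of_forall_minimalPrimes {A : Type*} [CommRing A]
    [IsNoetherianRing A] [IsReduced A] (J : Ideal A) (hJ : ∀ q ∈ minimalPrimes A, ¬ J ≤ q) :
    ∃ z ∈ A⁰, z ∈ J := by
  have h1 : ¬ (J : Set A) ⊆ ⋃ q ∈ minimalPrimes A, (q : Set A) := by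
    rw [Ideal.subset_union_prime_finite (minimalPrimes.finite_of_isNoetherianRing A) ⊥ ⊥
      fun q hq _ _ => hq.1.1]
    push Not
    exact hJ
  obtain ⟨z, hzJ, hz⟩ := Set.not_subset.1 h1
  simp only [Set.mem_iUnion, not_exists] at hz
  refine ⟨z, mem_nonZeroDivisors_iff_right.2 fun x hx => eq_zero_of_mem_minimalPrimes
    fun q hq => ?_, hzJ⟩
  exact (hq.1.1.mem_or_mem (hx ▸ q.zero_mem : x * z ∈ q)).resolve_right (hz q hq)

theorem exists_perturbation_top_coeff {A : Type u} [CommRing A] [IsNoetherianRing A] [IsReduced A]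
    {ι : Type} [Fintype ι] {n : ℕ} (hn : 2 ≤ n) (e : Matrix ι ι A) (he : e * e = e)
    (hrk : HasFibreRank e n) (Φ : ι → A[X]) (hΦ : Φ ᵥ* e.map C = Φ) {f : A[X]} (hf : f.Monic)
    (hfΦ : f ∈ Ideal.span (Set.range Φ)) :
    ∃ (Φ' : ι → A[X]) (M : ℕ), 2 ≤ M ∧ Φ' ᵥ* e.map C = Φ' ∧ f ∈ Ideal.span (Set.range Φ') ∧
      (∀ j, (Φ' j).natDegree ≤ M) ∧
      ∃ z ∈ A⁰, z ∈ Ideal.span (Set.range fun j => (Φ' j).coeff M) := by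
  classical
  obtain ⟨p, rfl⟩ := (Ideal.mem_span_range_iff_exists_fun ..).1 hfΦ
  have hfin := minimalPrimes.finite_of_isNoetherianRing A
  let T := {q // q ∈ minimalPrimes A}
  have : Fintype T := hfin.fintype
  have hΨ : ∀ q : T, ∃ (Ψ : ι → A[X]) (δ : ℕ), Ψ ᵥ* e.map C = Ψ ∧ ∑ j, p j * Ψ j = 0 ∧
      (∀ j i, δ < i → (Ψ j).coeff i ∈ q.1) ∧ ∃ j, (Ψ j).coeff δ ∉ q.1 := fun q => by
    have := q.2.1.1
    obtain ⟨Ψ, h1, h2, j, i, hi⟩ := exists_vecMul_eq_sum_mul_eq_zero hn e he hrk p Φ hΦ hf q.1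
    let S : Set ℕ := {i | ∃ j, (Ψ j).coeff i ∉ q.1}
    have hS : BddAbove S := by
      refine ⟨Finset.univ.sup fun j => (Ψ j).natDegree, fun i ⟨j, hj⟩ => ?_⟩
      have h3 : (Ψ j).coeff i ≠ 0 := fun h => hj (h ▸ q.1.zero_mem)
      exact (le_natDegree_of_ne_zero h3).trans
        (Finset.le_sup (f := fun j => (Ψ j).natDegree) (Finset.mem_univ j))
    have hne : S.Nonempty := ⟨i, j, hi⟩
    refine ⟨Ψ, sSup S, h1, h2, fun j i hi => ?_, Nat.sSup_mem hne hS⟩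
    by_contra hc
    exact (le_csSup hS ⟨j, hc⟩).not_gt hi
  choose Ψ δ hΨe hΨp hΨδ j₀ hj₀ using hΨ
  have hη : ∀ q : T, ∃ η ∉ q.1, ∀ q' : T, q' ≠ q → η ∈ q'.1 := fun q => by
    have := q.2.1.1
    have h1 : ¬ (Finset.univ.erase q).inf (fun q' : T => q'.1) ≤ q.1 := by
      rw [Ideal.IsPrime.inf_le' this]
      rintro ⟨q', hq', hle⟩
      exact (Finset.mem_erase.1 hq').1 (Subtype.ext (le_antisymm hle (q.2.2 q'.2.1 hle)))
    obtain ⟨η, h2, h3⟩ := SetLike.not_le_iff_exists.1 h1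
    refine ⟨η, h3, fun q' hq' => ?_⟩
    exact (Submodule.mem_finsetInf.1 h2) q' (Finset.mem_erase.2 ⟨hq', Finset.mem_univ _⟩)
  choose η hη hη' using hη
  let M := Finset.univ.sup (fun j => (Φ j).natDegree) + Finset.univ.sup δ + 2
  have hΦM : ∀ j i, M ≤ i → (Φ j).coeff i = 0 := fun j i hi => coeff_eq_zero_of_natDegree_lt (by
    have := Finset.le_sup (f := fun j => (Φ j).natDegree) (Finset.mem_univ j)
    lia)
  have hδM : ∀ q, δ q ≤ M := fun q => by
    have := Finset.le_sup (f := δ) (Finset.mem_univ q)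
    lia
  let Φ' : ι → A[X] := fun j => Φ j + ∑ q, C (η q) * X ^ (M - δ q) * Ψ q j
  have hcoeff : ∀ (q : T) (j : ι) (i : ℕ), M ≤ i →
      (Φ' j).coeff i - η q * (Ψ q j).coeff (i - (M - δ q)) ∈ q.1 := fun q j i hi => by
    have h1 : (Φ' j).coeff i = ∑ q, η q * (Ψ q j).coeff (i - (M - δ q)) := by
      simp only [Φ', coeff_add, hΦM j i hi, zero_add, finsetSum_coeff, mul_assoc, coeff_C_mul,
        coeff_X_pow_mul']
      refine Finset.sum_congr rfl fun q _ => ?_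
      rw [if_pos (by lia)]
    rw [h1, ← Finset.add_sum_erase _ _ (Finset.mem_univ q), add_sub_cancel_left]
    exact Ideal.sum_mem _ fun q' hq' =>
      Ideal.mul_mem_right _ _ (hη' q' q (Finset.mem_erase.1 hq').1.symm)
  refine ⟨Φ', M, by lia, ?_, ?_, fun j => ?_, ?_⟩
  · have h1 : Φ' = Φ + ∑ q, (C (η q) * X ^ (M - δ q)) • Ψ q := by
      funext j
      simp [Φ']
    rw [h1, add_vecMul, hΦ, sum_vecMul]
    simp only [smul_vecMul, hΨe]
  · refine (Ideal.mem_span_range_iff_exists_fun ..).2 ⟨p, ?_⟩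
    simp only [Φ', mul_add, Finset.sum_add_distrib, add_eq_left, Finset.mul_sum]
    rw [Finset.sum_comm]
    refine Finset.sum_eq_zero fun q _ => ?_
    simp only [mul_left_comm (p _), ← Finset.mul_sum, hΨp, mul_zero]
  · refine natDegree_le_iff_coeff_eq_zero.2 fun i hi => ?_
    refine eq_zero_of_mem_minimalPrimes fun q hq => ?_
    have h2 := hcoeff ⟨q, hq⟩ j i hi.le
    have h3 := hΨδ ⟨q, hq⟩ j (i - (M - δ ⟨q, hq⟩)) (by have := hδM ⟨q, hq⟩; lia)
    simpa using q.add_mem h2 (Ideal.mul_mem_left q (η ⟨q, hq⟩) h3)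
  · refine exists_mem_nonZeroDivisors_of_forall_minimalPrimes _ fun q hq hle => ?_
    have := hq.1.1
    have h2 := hcoeff ⟨q, hq⟩ (j₀ ⟨q, hq⟩) M le_rfl
    have h3 := hle (Ideal.subset_span (Set.mem_range_self (j₀ ⟨q, hq⟩)))
    have h4 := q.sub_mem h3 h2
    rw [sub_sub_cancel, Nat.sub_sub_self (hδM _)] at h4
    exact (this.mem_or_mem h4).elim (hη ⟨q, hq⟩) (hj₀ ⟨q, hq⟩)

theorem HasFibreRank.map {A : Type u} {B : Type u} [CommRing A] [CommRing B] {ι : Type} [Fintype ι]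
    {e : Matrix ι ι A} {n : ℕ} (h : HasFibreRank e n) (θ : A →+* B) :
    HasFibreRank (e.map θ) n := fun κ _ τ => by
  obtain ⟨D, D', h1, h2⟩ := h κ (τ.comp θ)
  exact ⟨D, D', h1, h2⟩

theorem exists_vecMul_eq_span_eq_top_of_isReduced (k : Type v) [Field k] [Infinite k] {A : Type u}
    [CommRing A] [Algebra k A] [IsNoetherianRing A] [IsReduced A] {ι : Type} [Fintype ι] {n : ℕ}
    (hn : ringKrullDim A + 2 ≤ (2 * n : ℕ)) (e : Matrix ι ι A)
    (he : e * e = e) (hrk : HasFibreRank e n) (Φ : ι → A[X])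
    (hΦ : Φ ᵥ* e.map C = Φ) {f : A[X]} (hf : f.Monic) (hfΦ : f ∈ Ideal.span (Set.range Φ)) :
    ∃ c : ι → A, c ᵥ* e = c ∧ Ideal.span (Set.range c) = ⊤ := by
  rcases subsingleton_or_nontrivial A with _ | _
  · exact ⟨0, Subsingleton.elim _ _, Subsingleton.elim _ _⟩
  by_cases h2 : 2 ≤ n
  · obtain ⟨Φ', M, hM, h3, h4, h5, z, hz, h6⟩ :=
      exists_perturbation_top_coeff h2 e he hrk Φ hΦ hf hfΦ
    exact exists_vecMul_eq_span_eq_top_of_coeff k hn e he hrk hz Φ' h3 hf h4 hM h5 h6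
  · have hdim : ringKrullDim A < Fintype.card (Fin n) := by
      rw [Fintype.card_fin]
      have h3 : (0 : WithBot ℕ∞) ≤ ringKrullDim A := ringKrullDim_nonneg_of_nontrivial
      induction hd : ringKrullDim A using WithBot.recBotCoe with
      | bot => exact WithBot.bot_lt_coe _
      | coe x =>
        rw [hd] at hn
        have h4 : x + 2 ≤ ((2 * n : ℕ) : ℕ∞) := WithBot.coe_le_coe.1 hn
        have h5 : x < (n : ℕ∞) := by
          induction x using ENat.recTopCoe with
          | top => exact absurd (top_le_iff.1 (by simpa using h4)) (ENat.natCast_ne_top (2 * n))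
          | coe y =>
            norm_cast at h4 ⊢
            lia
        exact_mod_cast h5
    obtain ⟨a, ha⟩ := exists_span_add_vecMul_eq_top k e 0 (fun q hq => by
      let := Ideal.Quotient.field q
      exact hrk (A ⧸ q) (Ideal.Quotient.mk q)) hdim
    rw [zero_add] at ha
    exact ⟨_, by rw [vecMul_vecMul, he], ha⟩

theorem eq_top_of_map_mk_nilradical_eq_top {A : Type*} [CommRing A] {I : Ideal A}
    (h : I.map (Ideal.Quotient.mk (nilradical A)) = ⊤) : I = ⊤ := by
  rw [← Ideal.radical_eq_top]
  have h1 := congrArg (Ideal.comap (Ideal.Quotient.mk (nilradical A))) h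
  rw [Ideal.comap_map_of_surjective _ Ideal.Quotient.mk_surjective, Ideal.comap_top] at h1
  rw [eq_top_iff, ← h1]
  refine sup_le Ideal.le_radical ?_
  rw [← RingHom.ker_eq_comap_bot, Ideal.mk_ker]
  exact Ideal.radical_mono bot_le

theorem exists_vecMul_eq_span_eq_top (k : Type v) [Field k] [Infinite k] {A : Type u}
    [CommRing A] [Algebra k A] [IsNoetherianRing A] {ι : Type} [Fintype ι] {n : ℕ}
    (hn : ringKrullDim A + 2 ≤ (2 * n : ℕ)) (e : Matrix ι ι A)
    (he : e * e = e) (hrk : HasFibreRank e n) (Φ : ι → A[X])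
    (hΦ : Φ ᵥ* e.map C = Φ) {f : A[X]} (hf : f.Monic) (hfΦ : f ∈ Ideal.span (Set.range Φ)) :
    ∃ c : ι → A, c ᵥ* e = c ∧ Ideal.span (Set.range c) = ⊤ := by
  let B := A ⧸ nilradical A
  let π : A →+* B := Ideal.Quotient.mk (nilradical A)
  have : IsReduced B := (Ideal.isRadical_iff_quotient_reduced _).1 (Ideal.radical_isRadical _)
  have hdim : ringKrullDim B ≤ ringKrullDim A :=
    ringKrullDim_le_of_surjective π Ideal.Quotient.mk_surjective
  obtain ⟨c', h1, h2⟩ := exists_vecMul_eq_span_eq_top_of_isReduced k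
    (A := B) ((add_le_add_left hdim 2).trans hn) (e.map π) (by rw [← Matrix.map_mul, he])
    (hrk.map π) (fun j => (Φ j).map π) (by
      funext j
      have h3 := congrArg (Polynomial.map π) (congrFun hΦ j)
      rw [← h3]
      simp [vecMul, dotProduct, Polynomial.map_sum]) (hf.map π) (by
      have h3 := Ideal.mem_map_of_mem (mapRingHom π) hfΦ
      rwa [Ideal.map_span, ← Set.range_comp] at h3)
  obtain ⟨c, hc⟩ : ∃ c : ι → A, ∀ j, π (c j) = c' j :=
    ⟨fun j => (Ideal.Quotient.mk_surjective (c' j)).choose,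
      fun j => (Ideal.Quotient.mk_surjective (c' j)).choose_spec⟩
  refine ⟨c ᵥ* e, by rw [vecMul_vecMul, he], eq_top_of_map_mk_nilradical_eq_top ?_⟩
  rw [Ideal.map_span, ← Set.range_comp, ← h2]
  congr 2
  funext j
  rw [← h1]
  have h4 : π ((c ᵥ* e) j) = ((π ∘ c) ᵥ* e.map π) j := RingHom.map_vecMul π e c j
  have h5 : π ∘ c = c' := funext hc
  rw [← h5]
  exact h4

/-- A finite dual basis: the Gram matrix `E` of a generating family and coordinate functionals. -/
structure IsDualFrame {R : Type*} [CommRing R] {M : Type*} [AddCommGroup M] [Module R M]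
    {ι : Type} [Fintype ι] (b : ι → M) (ξ : ι → M →ₗ[R] R) (E : Matrix ι ι R) : Prop where
  apply_eq : ∀ i j, ξ i (b j) = E i j
  sum_smul : ∀ x, ∑ j, ξ j x • b j = x

namespace IsDualFrame

variable {R : Type*} [CommRing R] {M : Type*} [AddCommGroup M] [Module R M]
  {ι : Type} [Fintype ι] {b : ι → M} {ξ : ι → M →ₗ[R] R} {E : Matrix ι ι R}

theorem mul_self (h : IsDualFrame b ξ E) : E * E = E := by
  ext i l
  rw [Matrix.mul_apply, ← h.apply_eq i l]
  conv_rhs => rw [← h.sum_smul (b l)]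
  simp [h.apply_eq, mul_comm]

theorem apply_vecMul (h : IsDualFrame b ξ E) (ψ : M →ₗ[R] R) :
    (fun j => ψ (b j)) ᵥ* E = fun j => ψ (b j) := by
  funext l
  conv_rhs => rw [← h.sum_smul (b l)]
  simp [vecMul, dotProduct, h.apply_eq, mul_comm]

theorem sum_mul_apply (h : IsDualFrame b ξ E) (ψ : M →ₗ[R] R) (x : M) :
    ∑ j, ξ j x * ψ (b j) = ψ x := by
  conv_rhs => rw [← h.sum_smul x]
  simp

theorem hasUnimodular (h : IsDualFrame b ξ E) {c : ι → R} (hc : c ᵥ* E = c)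
    (hspan : Ideal.span (Set.range c) = ⊤) : ∃ (m : M) (φ : M →ₗ[R] R), φ m = 1 := by
  obtain ⟨d, hd⟩ := (Ideal.mem_span_range_iff_exists_fun ..).1
    (hspan ▸ Submodule.mem_top : (1 : R) ∈ Ideal.span (Set.range c))
  refine ⟨∑ l, d l • b l, ∑ j, c j • ξ j, ?_⟩
  rw [← hd, map_sum]
  refine Finset.sum_congr rfl fun l _ => ?_
  conv_rhs => rw [← hc]
  simp [h.apply_eq, vecMul, dotProduct]

theorem localizedModule (h : IsDualFrame b ξ E) (S : Submonoid R) :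
    IsDualFrame (R := Localization S) (fun j => LocalizedModule.mkLinearMap S M (b j))
      (fun j => IsLocalizedModule.mapExtendScalars S (LocalizedModule.mkLinearMap S M)
        (Algebra.linearMap R (Localization S)) (Localization S) (ξ j))
      (E.map (algebraMap R (Localization S))) where
  apply_eq i j := by
    have h1 := IsLocalizedModule.map_apply S (LocalizedModule.mkLinearMap S M)
      (Algebra.linearMap R (Localization S)) (ξ i) (b j)
    rw [h.apply_eq] at h1
    exact h1
  sum_smul x := by
    let X : ι → LocalizedModule S M →ₗ[Localization S] Localization S := fun j =>
      IsLocalizedModule.mapExtendScalars S (LocalizedModule.mkLinearMap S M)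
        (Algebra.linearMap R (Localization S)) (Localization S) (ξ j)
    have h1 : (∑ j, (X j).smulRight (LocalizedModule.mkLinearMap S M (b j))).restrictScalars R =
        LinearMap.id := by
      refine IsLocalizedModule.linearMap_ext S (LocalizedModule.mkLinearMap S M)
        (LocalizedModule.mkLinearMap S M) (LinearMap.ext fun m => ?_)
      have h2 : ∀ j, X j (LocalizedModule.mkLinearMap S M m) =
          algebraMap R (Localization S) (ξ j m) := fun j =>
        IsLocalizedModule.map_apply S (LocalizedModule.mkLinearMap S M)
          (Algebra.linearMap R (Localization S)) (ξ j) m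
      simp only [LinearMap.comp_apply, LinearMap.restrictScalars_apply, LinearMap.sum_apply,
        LinearMap.smulRight_apply, h2, algebraMap_smul, LinearMap.id_apply, ← map_smul, ← map_sum,
        h.sum_smul]
    have h3 := LinearMap.congr_fun h1 x
    simp only [LinearMap.restrictScalars_apply, LinearMap.sum_apply,
      LinearMap.smulRight_apply] at h3
    exact h3

theorem exists_factorization [IsLocalRing R] (h : IsDualFrame b ξ E) {n : ℕ}
    (hrank : Module.rank R M = n) :
    ∃ (B : Matrix ι (Fin n) R) (B' : Matrix (Fin n) ι R), B' * B = 1 ∧ B * B' = E := by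
  let t : (ι → R) →ₗ[R] M := Fintype.linearCombination R b
  have ht : t ∘ₗ LinearMap.pi ξ = LinearMap.id := by
    ext x
    simpa [t, Fintype.linearCombination_apply] using h.sum_smul x
  have : Module.Projective R M := Module.Projective.of_split _ _ ht
  have : Module.Finite R M := Module.Finite.of_surjective t
    fun x => ⟨_, LinearMap.congr_fun ht x⟩
  have : Module.Free R M := Module.free_of_flat_of_isLocalRing
  have hfin : Module.finrank R M = n := by
    rw [Module.finrank, hrank, Cardinal.toNat_natCast]
  let β := Module.finBasisOfFinrankEq R M hfin
  refine ⟨.of fun i j => ξ i (β j), .of fun j i => β.repr (b i) j, ?_, ?_⟩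
  · ext j k
    have h1 := h.sum_mul_apply (β.coord j) (β k)
    rw [Matrix.mul_apply, Matrix.one_apply]
    simp only [Module.Basis.coord_apply, Module.Basis.repr_self, Finsupp.single_apply] at h1
    rw [← (if_congr eq_comm rfl rfl), ← h1]
    exact Finset.sum_congr rfl fun i _ => mul_comm _ _
  · ext i l
    have h1 := congrArg (ξ i) (β.sum_repr (b l))
    rw [Matrix.mul_apply, ← h.apply_eq, ← h1, map_sum]
    refine Finset.sum_congr rfl fun j _ => ?_
    rw [map_smul, smul_eq_mul, mul_comm]
    rfl

end IsDualFrame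

theorem exists_isDualFrame_of_linearEquiv {A : Type u} [CommRing A] {P : Type v} [AddCommGroup P]
    [Module A[X] P] {Q : Type u} [AddCommGroup Q] [Module A Q] [Module.Finite A Q]
    [Module.Projective A Q] (φ : P ≃ₗ[A[X]] A[X] ⊗[A] Q) :
    ∃ (r : ℕ) (e : Matrix (Fin r) (Fin r) A) (b : Fin r → P) (ξ : Fin r → P →ₗ[A[X]] A[X]),
      IsDualFrame b ξ (e.map C) := by
  obtain ⟨r, t, s, -, -, hts⟩ := Module.Finite.exists_comp_eq_id_of_projective A Q
  let g : Fin r → Q := fun j => t (Pi.single j 1)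
  let ξ : Fin r → A[X] ⊗[A] Q →ₗ[A[X]] A[X] := fun j =>
    (AlgebraTensorModule.rid A A[X] A[X]).toLinearMap ∘ₗ
      (LinearMap.proj j ∘ₗ s).baseChange A[X]
  have hξ : ∀ j a q, ξ j (a ⊗ₜ q) = a * C (s q j) := fun j a q => by
    simp [ξ, Algebra.smul_def, mul_comm]
  have hg : ∀ q, ∑ j, s q j • g j = q := fun q => by
    have h1 := LinearMap.congr_fun hts q
    rw [LinearMap.comp_apply, pi_eq_sum_univ' (s q), map_sum] at h1
    simp only [map_smul] at h1
    exact h1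
  refine ⟨r, .of fun i j => s (g j) i, fun j => φ.symm (1 ⊗ₜ g j), fun j => ξ j ∘ₗ φ.toLinearMap,
    fun i j => ?_, fun x => φ.injective ?_⟩
  · simp [hξ]
  · simp only [map_sum, map_smul, LinearEquiv.apply_symm_apply, LinearMap.comp_apply,
      LinearEquiv.coe_coe]
    induction φ x using TensorProduct.induction_on with
    | zero => simp
    | add y z hy hz => simp only [map_add, add_smul, Finset.sum_add_distrib, hy, hz]
    | tmul a q =>
      conv_rhs => rw [← hg q, TensorProduct.tmul_sum]
      refine Finset.sum_congr rfl fun j _ => ?_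
      rw [hξ, ← TensorProduct.smul_tmul, TensorProduct.smul_tmul', smul_eq_mul, mul_one,
        Algebra.smul_def, mul_comm]
      rfl

theorem IsDualFrame.hasFibreRank {A : Type u} [CommRing A] {P : Type v} [AddCommGroup P]
    [Module A[X] P] {ι : Type} [Fintype ι] {e : Matrix ι ι A} {b : ι → P}
    {ξ : ι → P →ₗ[A[X]] A[X]} (h : IsDualFrame b ξ (e.map C)) {n : ℕ}
    (hrank : ∀ p : PrimeSpectrum A[X], Module.rank (Localization.AtPrime p.asIdeal)
      (LocalizedModule p.asIdeal.primeCompl P) = n) : HasFibreRank e n := fun κ _ θ => by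
  let τ : A[X] →+* κ := eval₂RingHom θ 0
  let q : PrimeSpectrum A[X] := ⟨RingHom.ker τ, RingHom.ker_isPrime τ⟩
  have := q.isPrime
  obtain ⟨B, B', h1, h2⟩ :=
    (h.localizedModule q.asIdeal.primeCompl).exists_factorization (hrank q)
  let σ : Localization.AtPrime q.asIdeal →+* κ :=
    IsLocalization.lift (M := q.asIdeal.primeCompl) (g := τ) fun y =>
      (show τ y ≠ 0 from fun hy => y.2 hy).isUnit
  refine ⟨B.map σ, B'.map σ, ?_, ?_⟩
  · rw [← Matrix.map_mul, h1, Matrix.map_one _ σ.map_zero σ.map_one]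
  · rw [← Matrix.map_mul, h2]
    ext i j
    simp only [Matrix.map_apply]
    rw [IsLocalization.lift_eq]
    simp [τ]

theorem exists_pow_mem_span_range_of_localization {R : Type u} [CommRing R] {ι : Type} [Fintype ι]
    {E : Matrix ι ι R} {f : R} (hf : f ∈ R⁰) {x y : ι → Localization (Submonoid.powers f)}
    (hy : y ᵥ* E.map (algebraMap R (Localization (Submonoid.powers f))) = y)
    (hxy : ∑ j, x j * y j = 1) :
    ∃ (Φ : ι → R) (N : ℕ), Φ ᵥ* E = Φ ∧ f ^ N ∈ Ideal.span (Set.range Φ) := by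
  let S := Submonoid.powers f
  let L := Localization S
  let g : R →+* L := algebraMap R L
  have hinj : Function.Injective g :=
    IsLocalization.injective L (Submonoid.powers_le.2 hf)
  obtain ⟨⟨_, k, rfl⟩, hk⟩ := IsLocalization.exist_integer_multiples_of_finite S x
  obtain ⟨⟨_, l, rfl⟩, hl⟩ := IsLocalization.exist_integer_multiples_of_finite S y
  choose p hp using hk
  choose Φ hΦ using hl
  simp only [Algebra.smul_def] at hp hΦ
  have hΦ' : ∀ j, g (Φ j) = g (f ^ l) * y j := hΦ
  have hp' : ∀ j, g (p j) = g (f ^ k) * x j := hp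
  refine ⟨Φ, k + l, ?_, (Ideal.mem_span_range_iff_exists_fun ..).2 ⟨p, hinj ?_⟩⟩
  · funext j
    apply hinj
    have h1 := congrFun hy j
    rw [hΦ', ← h1]
    simp only [vecMul, dotProduct, map_sum, map_mul, hΦ', Finset.mul_sum, Matrix.map_apply,
      mul_assoc]
    rfl
  · rw [map_sum, pow_add, map_mul, ← mul_one (g (f ^ k) * _), ← hxy, Finset.mul_sum]
    refine Finset.sum_congr rfl fun j _ => ?_
    rw [map_mul, hp', hΦ', mul_mul_mul_comm]

theorem IsDualFrame.exists_pow_mem_span_range {R : Type u} [CommRing R] {P : Type v}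
    [AddCommGroup P] [Module R P] {ι : Type} [Fintype ι] {E : Matrix ι ι R} {b : ι → P}
    {ξ : ι → P →ₗ[R] R} (h : IsDualFrame b ξ E) {f : R} (hf : f ∈ R⁰)
    (hP : ∃ (m : LocalizedModule (Submonoid.powers f) P)
      (ψ : LocalizedModule (Submonoid.powers f) P →ₗ[Localization (Submonoid.powers f)]
        Localization (Submonoid.powers f)), ψ m = 1) :
    ∃ (Φ : ι → R) (N : ℕ), Φ ᵥ* E = Φ ∧ f ^ N ∈ Ideal.span (Set.range Φ) := by
  obtain ⟨m, ψ, hψ⟩ := hP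
  have hL := h.localizedModule (Submonoid.powers f)
  exact exists_pow_mem_span_range_of_localization hf (hL.apply_vecMul ψ)
    ((hL.sum_mul_apply ψ m).trans hψ)

end ExtendedProjective

/-- (Theorem 5.1) Let `A` be an affine `𝔽̄_p`-algebra of dimension `d` and `P` a finitely
generated projective `A[T]`-module of rank `n`, extended from `A`, with `2n ≥ d + 2`.  If `P_f`
has a unimodular element for some monic `f`, then `P` has a unimodular element. -/
theorem stmt10 (p : ℕ) [Fact p.Prime] (A : Type u) [CommRing A]
    [Algebra (AlgebraicClosure (ZMod p)) A]
    [Algebra.FiniteType (AlgebraicClosure (ZMod p)) A]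
    (d n : ℕ) (hdim : ringKrullDim A = d) (hn : d + 2 ≤ 2 * n)
    (P : Type v) [AddCommGroup P] [Module (Polynomial A) P]
    [Module.Finite (Polynomial A) P] [Module.Projective (Polynomial A) P]
    (hrank : HasRank (Polynomial A) P n)
    (hext : ∃ (Q : Type u) (_ : AddCommGroup Q) (_ : Module A Q),
      Module.Finite A Q ∧ Module.Projective A Q ∧
      Nonempty (P ≃ₗ[Polynomial A] (Polynomial A ⊗[A] Q)))
    (f : Polynomial A) (hf : f.Monic)
    (h : HasUnimodular (Localization (Submonoid.powers f))
      (LocalizedModule (Submonoid.powers f) P)) :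
    HasUnimodular (Polynomial A) P := by
  obtain ⟨Q, _, _, _, _, ⟨φ⟩⟩ := hext
  obtain ⟨r, e, b, ξ, hb⟩ := ExtendedProjective.exists_isDualFrame_of_linearEquiv φ
  have : IsNoetherianRing A :=
    Algebra.FiniteType.isNoetherianRing (AlgebraicClosure (ZMod p)) A
  have : Infinite (AlgebraicClosure (ZMod p)) := IsAlgClosed.instInfinite
  obtain ⟨Φ, N, hΦ, hN⟩ := hb.exists_pow_mem_span_range hf.mem_nonZeroDivisors h
  have he : e * e = e := by
    refine Matrix.map_injective Polynomial.C_injective ?_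
    exact (Matrix.map_mul (f := Polynomial.C)).trans hb.mul_self
  have hle : ringKrullDim A + 2 ≤ (2 * n : ℕ) := by
    rw [hdim]
    exact_mod_cast hn
  obtain ⟨c, hc, hspan⟩ := ExtendedProjective.exists_vecMul_eq_span_eq_top
    (AlgebraicClosure (ZMod p)) hle e he (hb.hasFibreRank hrank) Φ hΦ (hf.pow N) hN
  refine hb.hasUnimodular (c := fun j => Polynomial.C (c j)) ?_ ?_
  · funext j
    conv_rhs => rw [← hc]
    exact (RingHom.map_vecMul Polynomial.C e c j).symm
  · have h1 := congrArg (Ideal.map Polynomial.C) hspan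
    rwa [Ideal.map_span, ← Set.range_comp, Ideal.map_top] at h1
end
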